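/- There is a constant C > 0 such that the following holds. For every positive integer N and every nonempty set A ⊆ {1,…,N} with |A| = αN, the number of triples (a,b,c) ∈ A × A × A with a + c = 2b is at least exp(−C·(log(2/α))^{11})·N². -/

import Mathlib

namespace KM
open Finset
set_option linter.unusedSectionVars false
variable {G : Type*} [AddCommGroup G] [Fintype G] [DecidableEq G]

/-- indicator function of a finite set, real valued -/
def ind (A : Finset G) (x : G) : ℝ := if x ∈ A then 1 else 0

lemma ind_nonneg (A : Finset G) (x : G) : 0 ≤ ind A x := by unfold ind; split_ifs <;> norm_num
lemma ind_le_one (A : Finset G) (x : G) : ind A x ≤ 1 := by unfold ind; split_ifs <;> norm_num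

lemma sum_ind (A : Finset G) : ∑ x, ind A x = A.card := by
  unfold ind; simp

lemma sum_ind_mem (A B : Finset G) : ∑ x ∈ B, ind A x = (B ∩ A).card := by
  unfold ind; simp [Finset.sum_ite_mem]

/-- autocorrelation -/
def corr (f : G → ℝ) (x : G) : ℝ := ∑ y, f y * f (y + x)
/-- self-convolution -/
def cnv (f : G → ℝ) (x : G) : ℝ := ∑ y, f y * f (x - y)

lemma corr_sub (f : G → ℝ) (u v : G) : corr f (u - v) = ∑ s, f (s + u) * f (s + v) := by
  unfold corr
  rw [← Equiv.sum_comp (Equiv.addRight v)]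
  refine Finset.sum_congr rfl fun s _ => ?_
  simp only [Equiv.coe_addRight]
  rw [mul_comm]; congr 2; abel

lemma cnv_add (f : G → ℝ) (u v : G) : cnv f (u + v) = ∑ s, f (s + u) * f (-s + v) := by
  unfold cnv
  rw [← Equiv.sum_comp (Equiv.addRight u)]
  refine Finset.sum_congr rfl fun s _ => ?_
  simp only [Equiv.coe_addRight]
  congr 2; abel

def Phi (D : Finset G) (f : G → ℝ) (q : ℕ) (s : Fin q → G) : ℝ := ∑ u ∈ D, ∏ i, f (s i + u)

lemma weighted_pow_sum (D : Finset G) (f : G → ℝ) (q : ℕ) (φ : G → ℝ) :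
    ∑ u ∈ D, ∑ v ∈ D, φ (u - v) * corr f (u - v) ^ q =
      ∑ s : Fin q → G, ∑ u ∈ D, ∑ v ∈ D, φ (u - v) * ((∏ i, f (s i + u)) * ∏ i, f (s i + v)) := by
  rw [Finset.sum_comm]
  simp_rw [corr_sub, Fintype.sum_pow, Finset.mul_sum, Finset.prod_mul_distrib]
  rw [Finset.sum_comm]
  rw [Finset.sum_comm' (s := univ) (t' := D) (s' := fun _ => univ) (by simp)]
  refine Finset.sum_congr rfl fun u _ => ?_
  rw [Finset.sum_comm]

lemma corr_pow_sum (D : Finset G) (f : G → ℝ) (q : ℕ) :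
    ∑ u ∈ D, ∑ v ∈ D, corr f (u - v) ^ q = ∑ s : Fin q → G, Phi D f q s ^ 2 := by
  have := weighted_pow_sum D f q (fun _ => 1)
  simp only [one_mul] at this
  rw [this]
  refine Finset.sum_congr rfl fun s _ => ?_
  rw [sq, Phi, Finset.sum_mul_sum]

lemma corr_pow_sum_nonneg (D : Finset G) (f : G → ℝ) (q : ℕ) :
    0 ≤ ∑ u ∈ D, ∑ v ∈ D, corr f (u - v) ^ q := by
  rw [corr_pow_sum]; positivity

lemma cnv_pow_sum_le (D : Finset G) (f : G → ℝ) (q : ℕ) :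
    ∑ u ∈ D, ∑ v ∈ D, cnv f (u + v) ^ q ≤ ∑ u ∈ D, ∑ v ∈ D, corr f (u - v) ^ q := by
  have h1 : ∑ u ∈ D, ∑ v ∈ D, cnv f (u + v) ^ q =
      ∑ s : Fin q → G, Phi D f q s * Phi D f q (-s) := by
    simp_rw [cnv_add, Fintype.sum_pow, Finset.prod_mul_distrib, Phi, Finset.sum_mul_sum]
    rw [Finset.sum_comm' (s := univ) (t' := D) (s' := fun _ => univ) (by simp)]
    refine Finset.sum_congr rfl fun u _ => ?_
    rw [Finset.sum_comm]
    rfl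
  rw [h1, corr_pow_sum]
  have h2 : ∑ s : Fin q → G, Phi D f q (-s) ^ 2 = ∑ s : Fin q → G, Phi D f q s ^ 2 :=
    Equiv.sum_comp (Equiv.neg (Fin q → G)) (fun s => Phi D f q s ^ 2)
  have h3 : ∀ s : Fin q → G, Phi D f q s * Phi D f q (-s) ≤
      (Phi D f q s ^ 2 + Phi D f q (-s) ^ 2) / 2 := fun s => by
    nlinarith [sq_nonneg (Phi D f q s - Phi D f q (-s))]
  calc _ ≤ ∑ s : Fin q → G, (Phi D f q s ^ 2 + Phi D f q (-s) ^ 2) / 2 :=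
        Finset.sum_le_sum fun s _ => h3 s
    _ = _ := by rw [← Finset.sum_div, Finset.sum_add_distrib, h2]; ring

lemma choose_bound_aux (k : ℕ) : ∀ n, 16 * k ≤ n → 16 ^ k ≤ n.choose k := by
  induction k with
  | zero => intro n _; simp
  | succ k ih =>
    intro n hn
    obtain ⟨m, rfl⟩ : ∃ m, n = m + 1 := ⟨n - 1, by omega⟩
    have h1 := ih m (by omega)
    have h2 := Nat.add_one_mul_choose_eq m k
    have h3 : 16 * (k + 1) * 16 ^ k ≤ (m + 1) * m.choose k := Nat.mul_le_mul hn h1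
    rw [h2] at h3
    have h4 : 16 ^ (k + 1) * (k + 1) ≤ (m + 1).choose (k + 1) * (k + 1) := by
      calc _ = 16 * (k + 1) * 16 ^ k := by ring
        _ ≤ _ := h3
    exact Nat.le_of_mul_le_mul_right h4 (by omega)

lemma choose_bound (p : ℕ) : (16 : ℝ) ^ p ≤ ((16 * p).choose p : ℝ) := by
  exact_mod_cast choose_bound_aux p (16 * p) le_rfl

lemma unbalance (D : Finset G) (f : G → ℝ) (c : ℝ) (hc : 0 ≤ c) (p : ℕ) (hp : 0 < p)
    (h : (1 / 8 : ℝ) ^ p * (D.card : ℝ) ^ 2 ≤ ∑ u ∈ D, ∑ v ∈ D, (c * corr f (u - v)) ^ p) :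
    (2 : ℝ) ^ p * (D.card : ℝ) ^ 2 ≤
      ∑ u ∈ D, ∑ v ∈ D, (1 + c * corr f (u - v)) ^ (16 * p) := by
  have hmom : ∀ k, 0 ≤ ∑ u ∈ D, ∑ v ∈ D, (c * corr f (u - v)) ^ k := by
    intro k
    simp_rw [mul_pow, ← Finset.mul_sum]
    exact mul_nonneg (pow_nonneg hc _) (corr_pow_sum_nonneg D f k)
  have hexp : ∑ u ∈ D, ∑ v ∈ D, (1 + c * corr f (u - v)) ^ (16 * p) =
      ∑ k ∈ Finset.range (16 * p + 1), ((16 * p).choose k : ℝ) *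
        ∑ u ∈ D, ∑ v ∈ D, (c * corr f (u - v)) ^ k := by
    simp_rw [add_comm (1 : ℝ), add_pow, one_pow, mul_one, Finset.mul_sum]
    rw [Finset.sum_comm' (s := range _) (t' := D) (s' := fun _ => range (16 * p + 1)) (by simp [and_comm])]
    refine Finset.sum_congr rfl fun u _ => ?_
    rw [Finset.sum_comm]
    refine Finset.sum_congr rfl fun v _ => Finset.sum_congr rfl fun _ _ => by ring
  rw [hexp]
  calc (2 : ℝ) ^ p * (D.card : ℝ) ^ 2 = 16 ^ p * ((1 / 8 : ℝ) ^ p * (D.card : ℝ) ^ 2) := by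
        rw [← mul_assoc, ← mul_pow]; norm_num
    _ ≤ ((16 * p).choose p : ℝ) * ∑ u ∈ D, ∑ v ∈ D, (c * corr f (u - v)) ^ p :=
        mul_le_mul (choose_bound p) h (by positivity) (by positivity)
    _ ≤ _ := Finset.single_le_sum (f := fun k => ((16 * p).choose k : ℝ) *
        ∑ u ∈ D, ∑ v ∈ D, (c * corr f (u - v)) ^ k)
        (fun k _ => mul_nonneg (by positivity) (hmom k)) (by simp; omega)

/-- the bad pairs count -/
def badPairs (S : G → Prop) [DecidablePred S] (X : Finset G) : ℝ :=
  ∑ u ∈ X, ∑ v ∈ X, if S (u - v) then 0 else 1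

lemma prod_ind (A : Finset G) (q : ℕ) (s : Fin q → G) (u : G) :
    ∏ i, ind A (s i + u) = if ∀ i, s i + u ∈ A then 1 else 0 := by
  unfold ind
  rw [Finset.prod_ite_zero]; simp

lemma sift (A D : Finset G) (q : ℕ) (m δ ξ : ℝ) (hm : 0 < m) (hD : D.Nonempty) (hδ : 0 < δ)
    (hξ : ξ * 4 * (A.card : ℝ) ^ q ≤ m ^ q)
    (S : G → Prop) [DecidablePred S]
    (h1 : m ^ q * (D.card : ℝ) ^ 2 ≤ ∑ u ∈ D, ∑ v ∈ D, corr (ind A) (u - v) ^ q)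
    (h2 : ∑ u ∈ D, ∑ v ∈ D, (if S (u - v) then 0 else 1) * corr (ind A) (u - v) ^ q ≤
      δ / 2 * ∑ u ∈ D, ∑ v ∈ D, corr (ind A) (u - v) ^ q) :
    ∃ X ⊆ D, ξ * D.card ≤ X.card ∧ badPairs S X ≤ δ * (X.card : ℝ) ^ 2 := by
  by_contra hcon
  push Not at hcon
  set X : (Fin q → G) → Finset G := fun s => D.filter (fun u => ∀ i, s i + u ∈ A) with hX
  have hPhi : ∀ s, Phi D (ind A) q s = (X s).card := by
    intro s
    simp only [Phi, prod_ind, hX]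
    simp
  have hBad : ∀ s : Fin q → G, ∑ u ∈ D, ∑ v ∈ D, (if S (u - v) then (0:ℝ) else 1) *
      ((∏ i, ind A (s i + u)) * ∏ i, ind A (s i + v)) = badPairs S (X s) := by
    intro s
    simp only [badPairs, prod_ind, hX, Finset.sum_filter]
    refine Finset.sum_congr rfl fun u _ => ?_
    by_cases hu : ∀ i, s i + u ∈ A
    · simp only [if_pos hu]
      refine Finset.sum_congr rfl fun v _ => ?_
      by_cases hv : ∀ i, s i + v ∈ A
      · simp only [if_pos hv]; ring
      · simp only [if_neg hv]; ring
    · simp only [if_neg hu]; simp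
  have hsum : ∑ s : Fin q → G, ((X s).card : ℝ) = D.card * (A.card : ℝ) ^ q := by
    simp_rw [← hPhi, Phi]
    rw [Finset.sum_comm]
    have : ∀ u ∈ D, ∑ s : Fin q → G, ∏ i, ind A (s i + u) = (A.card : ℝ) ^ q := by
      intro u _
      rw [← Fintype.sum_pow (fun x => ind A (x + u)), ← sum_ind]
      congr 1
      exact Equiv.sum_comp (Equiv.addRight u) (ind A)
    rw [Finset.sum_congr rfl this]; simp
  have hpt : ∀ s, ((X s).card : ℝ) ^ 2 ≤ ξ * D.card * (X s).card + badPairs S (X s) / δ := by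
    intro s
    have hb0 : 0 ≤ badPairs S (X s) := by
      unfold badPairs
      exact Finset.sum_nonneg fun _ _ => Finset.sum_nonneg fun _ _ => by split_ifs <;> norm_num
    by_cases hc : ξ * D.card ≤ (X s).card
    · have h3 := hcon (X s) (Finset.filter_subset _ _) hc
      have h4 : ((X s).card : ℝ) ^ 2 ≤ badPairs S (X s) / δ := by
        rw [le_div_iff₀ hδ]; linarith
      by_cases hξ0 : 0 ≤ ξ
      · have : 0 ≤ ξ * D.card * (X s).card := by positivity
        linarith
      · exfalso
        have := hcon ∅ (by simp) (by
          simp; exact mul_nonpos_of_nonpos_of_nonneg (by linarith) (by positivity))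
        simp [badPairs] at this
    · have : ((X s).card : ℝ) ^ 2 ≤ ξ * D.card * (X s).card := by
        rw [sq]; exact mul_le_mul_of_nonneg_right (by linarith) (by positivity)
      have : 0 ≤ badPairs S (X s) / δ := by positivity
      linarith
  have htot := Finset.sum_le_sum (s := univ) fun s _ => hpt s
  rw [Finset.sum_add_distrib, ← Finset.mul_sum, hsum, ← Finset.sum_div] at htot
  rw [weighted_pow_sum D (ind A) q (fun x => if S x then 0 else 1), Finset.sum_congr rfl (fun s _ => hBad s)] at h2
  rw [corr_pow_sum] at h1 h2
  simp_rw [hPhi] at h1 h2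
  have hDpos : (0 : ℝ) < D.card := by exact_mod_cast hD.card_pos
  set H := ∑ s, ((X s).card : ℝ) ^ 2
  have h5 : (∑ s, badPairs S (X s)) / δ ≤ H / 2 := by
    rw [div_le_iff₀ hδ]; linarith
  have h6 : ξ * D.card * (D.card * (A.card : ℝ) ^ q) ≤ m ^ q * (D.card : ℝ) ^ 2 / 4 := by
    have := mul_le_mul_of_nonneg_right hξ (sq_nonneg (D.card : ℝ))
    nlinarith
  have h7 : 0 < m ^ q * (D.card : ℝ) ^ 2 := by positivity
  linarith
end KM

namespace KM
open Finset
set_option linter.unusedSectionVars false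
variable {G : Type*} [AddCommGroup G] [Fintype G] [DecidableEq G]

/-- `P` is almost invariant under translation by `x`. -/
def RegAt (P : Finset G) (δ : ℝ) (x : G) : Prop :=
  ((P.filter (fun y => y + x ∉ P)).card : ℝ) ≤ δ * P.card

lemma reg_sum {P Q : Finset G} (hQ : Q ⊆ P) {δ : ℝ} {x : G} (h : RegAt P δ x) :
    (Q.card : ℝ) - δ * P.card ≤ ∑ y, ind Q y * ind P (y + x) ∧
      ∑ y, ind Q y * ind P (y + x) ≤ Q.card := by
  constructor
  · have h1 : (Q.card : ℝ) ≤ ∑ y, ind Q y * ind P (y + x) +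
        ((P.filter (fun y => y + x ∉ P)).card : ℝ) := by
      rw [← sum_ind, ← sum_ind, ← Finset.sum_add_distrib]
      refine Finset.sum_le_sum fun y _ => ?_
      unfold ind
      by_cases h1 : y ∈ Q
      · have := hQ h1
        by_cases h2 : y + x ∈ P <;> simp [h1, h2, this]
      · simp only [h1, if_false, zero_mul, zero_add]; split_ifs <;> norm_num
    unfold RegAt at h; linarith
  · rw [← sum_ind]
    refine Finset.sum_le_sum fun y _ => ?_
    have := ind_nonneg Q y
    have := ind_le_one P (y + x)
    nlinarith

lemma corr_expand {P A : Finset G} (hA : A ⊆ P) {δ α : ℝ} (hα : (A.card : ℝ) = α * P.card)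
    (hα0 : 0 ≤ α) (hα1 : α ≤ 1) (hδ : 0 ≤ δ) {x : G} (h : RegAt P δ x) (h' : RegAt P δ (-x)) :
    |corr (ind A) x - corr (fun y => ind A y - α * ind P y) x - α ^ 2 * P.card|
      ≤ 2 * α * δ * P.card := by
  have e : corr (ind A) x - corr (fun y => ind A y - α * ind P y) x =
      α * (∑ y, ind A y * ind P (y + x) + ∑ y, ind A y * ind P (y + -x))
        - α ^ 2 * ∑ y, ind P y * ind P (y + x) := by
    have e1 : ∑ y, ind A y * ind P (y + -x) = ∑ y, ind A (y + x) * ind P y := by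
      rw [← Equiv.sum_comp (Equiv.addRight x)]
      refine Finset.sum_congr rfl fun y _ => by simp
    rw [e1]
    unfold corr
    rw [← Finset.sum_add_distrib, Finset.mul_sum, Finset.mul_sum, ← Finset.sum_sub_distrib,
      ← Finset.sum_sub_distrib]
    refine Finset.sum_congr rfl fun y _ => by ring
  rw [e]
  obtain ⟨a1, a2⟩ := reg_sum hA h
  obtain ⟨b1, b2⟩ := reg_sum hA h'
  obtain ⟨c1, c2⟩ := reg_sum (subset_refl P) h
  set X1 := ∑ y, ind A y * ind P (y + x)
  set X2 := ∑ y, ind A y * ind P (y + -x)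
  set X3 := ∑ y, ind P y * ind P (y + x)
  have hP : (0:ℝ) ≤ P.card := by positivity
  rw [hα] at a1 a2 b1 b2
  have d1 := mul_le_mul_of_nonneg_left (add_le_add a1 b1) hα0
  have d2 := mul_le_mul_of_nonneg_left (add_le_add a2 b2) hα0
  have d3 := mul_le_mul_of_nonneg_left c1 (sq_nonneg α)
  have d4 := mul_le_mul_of_nonneg_left c2 (sq_nonneg α)
  have d5 : α ^ 2 * (δ * P.card) ≤ 2 * (α * (δ * P.card)) := by
    have : 0 ≤ δ * P.card := by positivity
    have h2 : α ^ 2 ≤ α := by nlinarith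
    nlinarith [mul_le_mul_of_nonneg_right h2 this, mul_nonneg hα0 this]
  rw [abs_le]
  constructor <;> nlinarith

lemma cnv_expand {P A : Finset G} (hP : ∀ x, x ∈ P → -x ∈ P)
    (hA : A ⊆ P) {δ α : ℝ} (hα : (A.card : ℝ) = α * P.card)
    (hα0 : 0 ≤ α) (hα1 : α ≤ 1) (hδ : 0 ≤ δ) {x : G} (h' : RegAt P δ (-x)) :
    |cnv (ind A) x - cnv (fun y => ind A y - α * ind P y) x - α ^ 2 * P.card|
      ≤ 2 * α * δ * P.card := by
  have hneg : ∀ y, ind P (-y) = ind P y := by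
    intro y; unfold ind
    by_cases h : y ∈ P
    · simp [h, hP _ h]
    · have : -y ∉ P := fun h2 => h (by simpa using hP _ h2)
      simp [h, this]
  have hr : ∀ y, ind P (y + -x) = ind P (x - y) := by
    intro y; rw [← hneg]; congr 1; abel
  have e : cnv (ind A) x - cnv (fun y => ind A y - α * ind P y) x =
      α * (2 * ∑ y, ind A y * ind P (y + -x))
        - α ^ 2 * ∑ y, ind P y * ind P (y + -x) := by
    have e1 : ∑ y, ind A y * ind P (y + -x) = ∑ y, ind A (x - y) * ind P y := by
      rw [← Equiv.sum_comp (Equiv.subLeft x)]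
      refine Finset.sum_congr rfl fun y _ => ?_
      rw [hr]; simp
    rw [two_mul]
    nth_rewrite 2 [e1]
    simp_rw [hr]
    unfold cnv
    rw [← Finset.sum_add_distrib, Finset.mul_sum, Finset.mul_sum, ← Finset.sum_sub_distrib,
      ← Finset.sum_sub_distrib]
    refine Finset.sum_congr rfl fun y _ => by ring
  rw [e]
  obtain ⟨b1, b2⟩ := reg_sum hA h'
  obtain ⟨c1, c2⟩ := reg_sum (subset_refl P) h'
  set X2 := ∑ y, ind A y * ind P (y + -x)
  set X3 := ∑ y, ind P y * ind P (y + -x)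
  have hP : (0:ℝ) ≤ P.card := by positivity
  rw [hα] at b1 b2
  have d1 := mul_le_mul_of_nonneg_left b1 hα0
  have d2 := mul_le_mul_of_nonneg_left b2 hα0
  have d3 := mul_le_mul_of_nonneg_left c1 (sq_nonneg α)
  have d4 := mul_le_mul_of_nonneg_left c2 (sq_nonneg α)
  have d5 : α ^ 2 * (δ * P.card) ≤ 2 * (α * (δ * P.card)) := by
    have : 0 ≤ δ * P.card := by positivity
    have h2 : α ^ 2 ≤ α := by nlinarith
    nlinarith [mul_le_mul_of_nonneg_right h2 this, mul_nonneg hα0 this]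
  rw [abs_le]
  constructor <;> nlinarith

lemma corr_ind_nonneg (A : Finset G) (x : G) : 0 ≤ corr (ind A) x :=
  Finset.sum_nonneg fun _ _ => mul_nonneg (ind_nonneg _ _) (ind_nonneg _ _)

/-- From few progressions to a large moment of the autocorrelation. -/
lemma moment_lower (ℓ : ℕ) (hℓ : 1 ≤ ℓ) {P A D : Finset G} (hP : ∀ x, x ∈ P → -x ∈ P)
    (hD : ∀ x, x ∈ D → -x ∈ D) (hDne : D.Nonempty)
    (hA : A ⊆ P) {δ α : ℝ} (hα : (A.card : ℝ) = α * P.card) (hPne : P.Nonempty)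
    (hα0 : 0 < α) (hα1 : α ≤ 1) (hδ : 0 ≤ δ) (hδα : 2000 * δ ≤ α)
    (hreg : ∀ u ∈ D, ∀ v ∈ D, RegAt P δ (u - v))
    (ω : G → G → ℝ) (hω0 : ∀ u v, 0 ≤ ω u v) (hω1 : ∀ u v, ω u v ≤ 1)
    (hω : (1 / 2 : ℝ) ^ (ℓ + 1) * (D.card : ℝ) ^ 2 ≤ ∑ u ∈ D, ∑ v ∈ D, ω u v)
    (hfew : ∑ u ∈ D, ∑ v ∈ D, ω u v * cnv (ind A) (u + v) ≤
      (1 / 2) * (α ^ 2 * P.card) * ∑ u ∈ D, ∑ v ∈ D, ω u v) :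
    (1.9 : ℝ) ^ (40 * ℓ) * (D.card : ℝ) ^ 2 ≤
      ∑ u ∈ D, ∑ v ∈ D, (corr (ind A) (u - v) / (α ^ 2 * P.card)) ^ (16 * (40 * ℓ)) := by
  set p := 40 * ℓ with hp
  set m : ℝ := α ^ 2 * P.card with hm
  have hPc : (0 : ℝ) < P.card := by exact_mod_cast hPne.card_pos
  have hDc : (0 : ℝ) < D.card := by exact_mod_cast hDne.card_pos
  have hm0 : 0 < m := by positivity
  set f : G → ℝ := fun y => ind A y - α * ind P y with hf
  have hreg' : ∀ u ∈ D, ∀ v ∈ D, RegAt P δ (-(u - v)) := fun u hu v hv => by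
    rw [neg_sub]; exact hreg v hv u hu
  have hreg'' : ∀ u ∈ D, ∀ v ∈ D, RegAt P δ (-(u + v)) := fun u hu v hv => by
    have := hreg (-u) (hD u hu) v hv
    rwa [show -(u + v) = -u - v by abel]
  have herr : 2 * α * δ * P.card ≤ m / 1000 := by
    have := mul_le_mul_of_nonneg_left hδα (by positivity : 0 ≤ α * P.card)
    rw [hm]; nlinarith
  set W := ∑ u ∈ D, ∑ v ∈ D, ω u v with hW
  have hW0 : 0 < W := lt_of_lt_of_le (by positivity) hω
  -- Hölder
  have hold : (1 / 4 : ℝ) ^ p * W ≤ ∑ u ∈ D, ∑ v ∈ D, ω u v * (1 / m * cnv f (u + v)) ^ p := by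
    have hev : Even p := ⟨20 * ℓ, by omega⟩
    have key := Real.pow_arith_mean_le_arith_mean_pow_of_even (D ×ˢ D)
      (fun z => ω z.1 z.2 / W) (fun z => 1 / m * cnv f (z.1 + z.2))
      (fun z _ => div_nonneg (hω0 _ _) hW0.le)
      (by rw [← Finset.sum_div, Finset.sum_product, ← hW, div_self hW0.ne']) hev
    rw [Finset.sum_product, Finset.sum_product] at key
    have e1 : ∑ u ∈ D, ∑ v ∈ D, ω u v / W * (1 / m * cnv f (u + v)) ≤ -(1 / 4) := by
      have : ∀ u ∈ D, ∀ v ∈ D, ω u v / W * (1 / m * cnv f (u + v)) ≤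
          (1 / (m * W)) * (ω u v * cnv (ind A) (u + v)) - (999 / 1000) / W * ω u v := by
        intro u hu v hv
        have h1 := (abs_le.1 (cnv_expand hP hA hα hα0.le hα1 hδ (hreg'' u hu v hv))).1
        have h2 : cnv f (u + v) ≤ cnv (ind A) (u + v) - 999 / 1000 * m := by
          simp only [← hf, ← hm] at h1; linarith
        have h3 : ω u v / W * (1 / m * cnv f (u + v)) ≤
            ω u v / W * (1 / m * (cnv (ind A) (u + v) - 999 / 1000 * m)) := by
          have := hω0 u v
          gcongr
        refine h3.trans (le_of_eq ?_)
        field_simp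
      have h4 := Finset.sum_le_sum fun u hu => Finset.sum_le_sum fun v hv => this u hu v hv
      refine h4.trans ?_
      simp_rw [Finset.sum_sub_distrib, ← Finset.mul_sum]
      rw [← hW]
      have : 1 / (m * W) * ∑ u ∈ D, ∑ v ∈ D, ω u v * cnv (ind A) (u + v) ≤
          1 / (m * W) * (1 / 2 * m * W) := by gcongr
      have e5 : 1 / (m * W) * (1 / 2 * m * W) = 1 / 2 := by field_simp
      have e6 : 999 / 1000 / W * W = 999 / 1000 := by field_simp
      linarith
    have e2 : (1 / 4 : ℝ) ^ p ≤ (∑ u ∈ D, ∑ v ∈ D, ω u v / W * (1 / m * cnv f (u + v))) ^ p := by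
      rw [← hev.neg_pow (∑ u ∈ D, ∑ v ∈ D, ω u v / W * (1 / m * cnv f (u + v)))]
      exact pow_le_pow_left₀ (by norm_num) (by linarith) _
    have e3 := e2.trans key
    have e4 : ∑ u ∈ D, ∑ v ∈ D, ω u v / W * (1 / m * cnv f (u + v)) ^ p =
        (∑ u ∈ D, ∑ v ∈ D, ω u v * (1 / m * cnv f (u + v)) ^ p) / W := by
      simp_rw [Finset.sum_div]
      refine Finset.sum_congr rfl fun u _ => Finset.sum_congr rfl fun v _ => by ring
    rw [e4, le_div_iff₀ hW0] at e3
    exact e3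
  have hev : Even p := ⟨20 * ℓ, by omega⟩
  have step1 : (1 / 8 : ℝ) ^ p * (D.card : ℝ) ^ 2 ≤
      ∑ u ∈ D, ∑ v ∈ D, (1 / m * corr f (u - v)) ^ p := by
    have a1 : ∑ u ∈ D, ∑ v ∈ D, ω u v * (1 / m * cnv f (u + v)) ^ p ≤
        ∑ u ∈ D, ∑ v ∈ D, (1 / m * cnv f (u + v)) ^ p := by
      refine Finset.sum_le_sum fun u _ => Finset.sum_le_sum fun v _ => ?_
      have := hev.pow_nonneg (1 / m * cnv f (u + v))
      have := hω1 u v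
      nlinarith
    have a2 : ∑ u ∈ D, ∑ v ∈ D, (1 / m * cnv f (u + v)) ^ p ≤
        ∑ u ∈ D, ∑ v ∈ D, (1 / m * corr f (u - v)) ^ p := by
      simp_rw [mul_pow, ← Finset.mul_sum]
      exact mul_le_mul_of_nonneg_left (cnv_pow_sum_le D f p) (by positivity)
    have a3 : (1 / 8 : ℝ) ^ p * (D.card : ℝ) ^ 2 ≤ (1 / 4 : ℝ) ^ p * W := by
      calc (1 / 8 : ℝ) ^ p * (D.card : ℝ) ^ 2 = (1 / 4 : ℝ) ^ p * ((1 / 2) ^ p * (D.card : ℝ) ^ 2) := by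
            rw [← mul_assoc, ← mul_pow]; norm_num
        _ ≤ (1 / 4 : ℝ) ^ p * ((1 / 2) ^ (ℓ + 1) * (D.card : ℝ) ^ 2) := by
            gcongr ?_ * (?_ * ?_)
            exact pow_le_pow_of_le_one (by norm_num) (by norm_num) (by omega)
        _ ≤ _ := by gcongr
    linarith
  have step2 := unbalance D f (1 / m) (by positivity) p (by omega) step1
  set H := ∑ u ∈ D, ∑ v ∈ D, (corr (ind A) (u - v) / m) ^ (16 * p) with hH
  have step3 : ∑ u ∈ D, ∑ v ∈ D, (1 + 1 / m * corr f (u - v)) ^ (16 * p) ≤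
      (1.02 : ℝ) ^ p * (H + (D.card : ℝ) ^ 2) := by
    have hc : (D.card : ℝ) ^ 2 = ∑ u ∈ D, ∑ v ∈ D, (1 : ℝ) := by simp [sq]
    rw [hc, hH, ← Finset.sum_add_distrib, Finset.mul_sum]
    refine Finset.sum_le_sum fun u hu => ?_
    rw [← Finset.sum_add_distrib, Finset.mul_sum]
    refine Finset.sum_le_sum fun v hv => ?_
    obtain ⟨h1, h2⟩ := abs_le.1 (corr_expand hA hα hα0.le hα1 hδ (hreg u hu v hv) (hreg' u hu v hv))
    simp only [← hf, ← hm] at h1 h2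
    set h := corr (ind A) (u - v) / m with hh
    have hh0 : 0 ≤ h := div_nonneg (corr_ind_nonneg _ _) hm0.le
    have hcm : corr (ind A) (u - v) = h * m := by rw [hh]; field_simp
    have hg : 1 / m * corr f (u - v) * m = corr f (u - v) := by field_simp
    set g := 1 / m * corr f (u - v)
    rw [hcm, ← hg] at h1 h2
    have b1 : 1 + g ≤ h + 1 / 1000 := by
      by_contra hc; push Not at hc
      have := mul_lt_mul_of_pos_right hc hm0
      nlinarith
    have b2 : -(h + 1 / 1000) ≤ 1 + g := by
      by_contra hc; push Not at hc
      have := mul_lt_mul_of_pos_right hc hm0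
      have := mul_nonneg hh0 hm0.le
      nlinarith
    have b3 : |1 + g| ≤ 1.001 * max h 1 := by
      have m1 := le_max_left h 1
      have m2 := le_max_right h 1
      rw [abs_le]; constructor <;> linarith
    have hev2 : Even (16 * p) := ⟨8 * p, by omega⟩
    calc (1 + g) ^ (16 * p) = |1 + g| ^ (16 * p) := (hev2.pow_abs _).symm
      _ ≤ (1.001 * max h 1) ^ (16 * p) := pow_le_pow_left₀ (abs_nonneg _) b3 _
      _ = ((1.001 : ℝ) ^ 16) ^ p * (max h 1) ^ (16 * p) := by rw [mul_pow, pow_mul]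
      _ ≤ (1.02 : ℝ) ^ p * (h ^ (16 * p) + 1) := by
          gcongr
          · norm_num
          · rcases le_total h 1 with h4 | h4
            · rw [max_eq_right h4, one_pow]; have := pow_nonneg hh0 (16 * p); linarith
            · rw [max_eq_left h4]; linarith
  have step4 := step2.trans step3
  -- numerics
  have n1 : (1.02 : ℝ) ^ p * (2 * 1.9 ^ p) ≤ 2 ^ p := by
    have : (2 : ℝ) ≤ (1.03 : ℝ) ^ p := by
      have := one_add_mul_le_pow (a := (0.03 : ℝ)) (by norm_num) p
      have hp' : (40 : ℝ) ≤ p := by exact_mod_cast (by omega : 40 ≤ p)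
      calc (2 : ℝ) ≤ 1 + p * 0.03 := by linarith
        _ ≤ _ := this
        _ = _ := by norm_num
    calc (1.02 : ℝ) ^ p * (2 * 1.9 ^ p) ≤ (1.02 : ℝ) ^ p * (1.03 ^ p * 1.9 ^ p) := by gcongr
      _ = (1.02 * (1.03 * 1.9)) ^ p := by rw [mul_pow, mul_pow]
      _ ≤ _ := by gcongr; norm_num
  have n2 : (1 : ℝ) ≤ 1.9 ^ p := one_le_pow₀ (by norm_num)
  have n3 : (1.02 : ℝ) ^ p * (2 * 1.9 ^ p * (D.card : ℝ) ^ 2) ≤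
      (1.02 : ℝ) ^ p * (H + (D.card : ℝ) ^ 2) := by
    refine le_trans ?_ step4
    rw [← mul_assoc]; gcongr
  have n4 := le_of_mul_le_mul_left n3 (by positivity)
  nlinarith [sq_nonneg (D.card : ℝ)]

/-- Conclusion of the sifting part. -/
lemma propA (ℓ : ℕ) (hℓ : 1 ≤ ℓ) {P A D : Finset G} (hP : ∀ x, x ∈ P → -x ∈ P)
    (hD : ∀ x, x ∈ D → -x ∈ D) (hDne : D.Nonempty)
    (hA : A ⊆ P) {δ α : ℝ} (hα : (A.card : ℝ) = α * P.card) (hPne : P.Nonempty)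
    (hα0 : (1 / 2 : ℝ) ^ (ℓ + 1) ≤ α) (hα1 : α ≤ 1) (hδ : 0 ≤ δ) (hδα : 2000 * δ ≤ α)
    (hreg : ∀ u ∈ D, ∀ v ∈ D, RegAt P δ (u - v))
    (ω : G → G → ℝ) (hω0 : ∀ u v, 0 ≤ ω u v) (hω1 : ∀ u v, ω u v ≤ 1)
    (hω : (1 / 2 : ℝ) ^ (ℓ + 1) * (D.card : ℝ) ^ 2 ≤ ∑ u ∈ D, ∑ v ∈ D, ω u v)
    (hfew : ∑ u ∈ D, ∑ v ∈ D, ω u v * cnv (ind A) (u + v) ≤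
      (1 / 2) * (α ^ 2 * P.card) * ∑ u ∈ D, ∑ v ∈ D, ω u v)
    (S : G → Prop) [DecidablePred S]
    (hS : ∀ x, S x ↔ 1.025 * (α ^ 2 * P.card) ≤ corr (ind A) x) :
    ∃ X ⊆ D, (1 / 2 : ℝ) ^ (1300 * ℓ ^ 2) * D.card ≤ X.card ∧
      badPairs S X ≤ 0.002 * (X.card : ℝ) ^ 2 := by
  have hα0' : 0 < α := lt_of_lt_of_le (by positivity) hα0
  have hmom := moment_lower ℓ hℓ hP hD hDne hA hα hPne hα0' hα1 hδ hδα hreg ω hω0 hω1 hω hfew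
  have hPc : (0 : ℝ) < P.card := by exact_mod_cast hPne.card_pos
  have hDc : (0 : ℝ) < D.card := by exact_mod_cast hDne.card_pos
  set m : ℝ := α ^ 2 * P.card with hm
  have hm0 : 0 < m := by positivity
  set p := 40 * ℓ with hp
  have hcorr : ∀ x, corr (ind A) x ^ (16 * p) = m ^ (16 * p) * (corr (ind A) x / m) ^ (16 * p) := by
    intro x; rw [← mul_pow]; congr 1; field_simp
  have n2 : (1 : ℝ) ≤ 1.9 ^ p := one_le_pow₀ (by norm_num)
  refine sift A D (16 * p) m 0.002 _ hm0 hDne (by norm_num) ?_ S ?_ ?_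
  · have e1 : m = α * A.card := by rw [hα, hm]; ring
    rw [e1, mul_pow]
    refine mul_le_mul_of_nonneg_right ?_ (by positivity)
    have e2 : ((1 / 2 : ℝ) ^ (ℓ + 1)) ^ (16 * p) ≤ α ^ (16 * p) := by gcongr
    refine le_trans ?_ e2
    rw [← pow_mul]
    have e3 : (4 : ℝ) = ((1 / 2 : ℝ) ^ 2)⁻¹ := by norm_num
    rw [e3, ← div_eq_mul_inv, div_le_iff₀ (by positivity), ← pow_add]
    refine pow_le_pow_of_le_one (by norm_num) (by norm_num) ?_
    rw [hp]
    nlinarith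
  · simp_rw [hcorr, ← Finset.mul_sum]
    gcongr
    nlinarith [sq_nonneg (D.card : ℝ)]
  · simp_rw [hcorr]
    have e1 : ∑ u ∈ D, ∑ v ∈ D, (if S (u - v) then (0:ℝ) else 1) *
        (m ^ (16 * p) * (corr (ind A) (u - v) / m) ^ (16 * p)) ≤
        ∑ u ∈ D, ∑ v ∈ D, m ^ (16 * p) * (1.5 : ℝ) ^ p := by
      refine Finset.sum_le_sum fun u _ => Finset.sum_le_sum fun v _ => ?_
      by_cases h : S (u - v)
      · simp only [if_pos h, zero_mul]; positivity
      · simp only [if_neg h, one_mul]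
        rw [hS] at h
        push Not at h
        have h0 : 0 ≤ corr (ind A) (u - v) / m := div_nonneg (corr_ind_nonneg _ _) hm0.le
        have h1 : corr (ind A) (u - v) / m ≤ 1.025 := by
          rw [div_le_iff₀ hm0]; exact h.le
        gcongr
        calc (corr (ind A) (u - v) / m) ^ (16 * p) ≤ 1.025 ^ (16 * p) := by gcongr
          _ = ((1.025 : ℝ) ^ 16) ^ p := by rw [pow_mul]
          _ ≤ _ := by gcongr; norm_num
    refine e1.trans ?_
    simp_rw [← Finset.mul_sum]
    simp only [Finset.sum_const, nsmul_eq_mul]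
    have n5 : (1.5 : ℝ) ^ p ≤ 0.001 * 1.9 ^ p := by
      have : (1.5 / 1.9 : ℝ) ^ p ≤ 0.001 := by
        rw [hp, pow_mul]
        calc ((1.5 / 1.9 : ℝ) ^ 40) ^ ℓ ≤ (0.001 : ℝ) ^ ℓ := by gcongr; norm_num
          _ ≤ 0.001 ^ 1 := pow_le_pow_of_le_one (by norm_num) (by norm_num) hℓ
          _ = _ := by norm_num
      rw [div_pow, div_le_iff₀ (by positivity)] at this
      exact this
    set H := ∑ u ∈ D, ∑ v ∈ D, (corr (ind A) (u - v) / m) ^ (16 * p)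
    have n6 : (1.5 : ℝ) ^ p * (D.card : ℝ) ^ 2 ≤ 0.001 * H := by
      have := mul_le_mul_of_nonneg_right n5 (sq_nonneg (D.card : ℝ))
      linarith
    have n7 := mul_le_mul_of_nonneg_left n6 (by positivity : 0 ≤ m ^ (16 * p))
    calc _ = m ^ (16 * p) * (1.5 ^ p * (D.card : ℝ) ^ 2) := by ring
      _ ≤ _ := n7
      _ = _ := by ring
end KM

namespace KM
open Finset
set_option linter.unusedSectionVars false
variable {G : Type*} [AddCommGroup G] [Fintype G] [DecidableEq G]

lemma tail_one (X : Finset G) (Z : G → ℝ) (hZ : ∀ x ∈ X, |Z x| ≤ 1)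
    (hZ0 : ∑ x ∈ X, Z x = 0) (n : ℕ) (ε : ℝ) (hε : 0 < ε) :
    (((Fintype.piFinset fun _ : Fin n => X).filter (fun a => ε * n < ∑ i, Z (a i))).card : ℝ) ≤
      Real.exp (-(n * ε ^ 2 / 2)) * (X.card : ℝ) ^ n := by
  have h1 : ∑ a ∈ Fintype.piFinset fun _ : Fin n => X, Real.exp (ε * ∑ i, Z (a i)) ≤
      (X.card : ℝ) ^ n * Real.exp (n * ε ^ 2 / 2) := by
    have e1 : ∑ a ∈ Fintype.piFinset fun _ : Fin n => X, Real.exp (ε * ∑ i, Z (a i)) =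
        (∑ x ∈ X, Real.exp (ε * Z x)) ^ n := by
      rw [Finset.sum_pow']
      refine Finset.sum_congr rfl fun a _ => ?_
      rw [Finset.mul_sum, Real.exp_sum]
    rw [e1]
    have e2 : ∑ x ∈ X, Real.exp (ε * Z x) ≤ X.card * Real.exp (ε ^ 2 / 2) := by
      calc ∑ x ∈ X, Real.exp (ε * Z x) ≤ ∑ x ∈ X, (Real.cosh ε + Z x * Real.sinh ε) := by
            refine Finset.sum_le_sum fun x hx => ?_
            rw [mul_comm]; exact Real.exp_mul_le_cosh_add_mul_sinh (hZ x hx) ε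
        _ = X.card * Real.cosh ε := by
            rw [Finset.sum_add_distrib, ← Finset.sum_mul, hZ0]; simp
        _ ≤ _ := by gcongr; exact Real.cosh_le_exp_half_sq ε
    calc _ ≤ (X.card * Real.exp (ε ^ 2 / 2)) ^ n := by
          gcongr
      _ = _ := by rw [mul_pow, ← Real.exp_nat_mul]; ring_nf
  set 𝓑 := (Fintype.piFinset fun _ : Fin n => X).filter (fun a => ε * n < ∑ i, Z (a i)) with hB
  have h2 : (𝓑.card : ℝ) * Real.exp (n * ε ^ 2) ≤
      ∑ a ∈ Fintype.piFinset fun _ : Fin n => X, Real.exp (ε * ∑ i, Z (a i)) := by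
    calc (𝓑.card : ℝ) * Real.exp (n * ε ^ 2) = ∑ a ∈ 𝓑, Real.exp (n * ε ^ 2) := by simp
      _ ≤ ∑ a ∈ 𝓑, Real.exp (ε * ∑ i, Z (a i)) := by
          refine Finset.sum_le_sum fun a ha => Real.exp_le_exp.2 ?_
          have := (Finset.mem_filter.1 ha).2
          nlinarith
      _ ≤ _ := Finset.sum_le_sum_of_subset_of_nonneg (Finset.filter_subset _ _)
          fun _ _ _ => (Real.exp_pos _).le
  have h3 := h2.trans h1
  have h4 : Real.exp (n * ε ^ 2 / 2) = Real.exp (-(n * ε ^ 2 / 2)) * Real.exp (n * ε ^ 2) := by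
    rw [← Real.exp_add]; ring_nf
  rw [h4] at h3
  have := Real.exp_pos (n * ε ^ 2)
  refine le_of_mul_le_mul_right (h3.trans (le_of_eq ?_)) this
  ring

lemma tail_two (X : Finset G) (Z : G → ℝ) (hZ : ∀ x ∈ X, |Z x| ≤ 1)
    (hZ0 : ∑ x ∈ X, Z x = 0) (n : ℕ) (ε : ℝ) (hε : 0 < ε) :
    (((Fintype.piFinset fun _ : Fin n => X).filter (fun a => ε * n < |∑ i, Z (a i)|)).card : ℝ) ≤
      2 * Real.exp (-(n * ε ^ 2 / 2)) * (X.card : ℝ) ^ n := by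
  have h1 := tail_one X Z hZ hZ0 n ε hε
  have h2 := tail_one X (fun x => - Z x) (fun x hx => by rw [abs_neg]; exact hZ x hx)
    (by simp [hZ0]) n ε hε
  have h3 : ((Fintype.piFinset fun _ : Fin n => X).filter (fun a => ε * n < |∑ i, Z (a i)|)) ⊆
      ((Fintype.piFinset fun _ : Fin n => X).filter (fun a => ε * n < ∑ i, Z (a i))) ∪
      ((Fintype.piFinset fun _ : Fin n => X).filter (fun a => ε * n < ∑ i, - Z (a i))) := by
    intro a ha
    rw [Finset.mem_filter, lt_abs] at ha
    rw [Finset.mem_union, Finset.mem_filter, Finset.mem_filter, Finset.sum_neg_distrib]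
    tauto
  have h4 : (((Fintype.piFinset fun _ : Fin n => X).filter
      (fun a => ε * n < |∑ i, Z (a i)|)).card : ℝ) ≤ _ :=
    Nat.cast_le.2 ((Finset.card_le_card h3).trans (Finset.card_union_le _ _))
  push_cast at h4
  linarith

/-- average of `φ` over `y - X` -/
noncomputable def avX (X : Finset G) (φ : G → ℝ) (y : G) : ℝ := (∑ x ∈ X, φ (y - x)) / X.card

lemma avX_mem (X : Finset G) (φ : G → ℝ) (h0 : ∀ x, 0 ≤ φ x) (h1 : ∀ x, φ x ≤ 1) (y : G) :
    0 ≤ avX X φ y ∧ avX X φ y ≤ 1 := by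
  unfold avX
  refine ⟨div_nonneg (Finset.sum_nonneg fun _ _ => h0 _) (by positivity), ?_⟩
  refine div_le_one_of_le₀ ?_ (by positivity)
  calc ∑ x ∈ X, φ (y - x) ≤ ∑ x ∈ X, (1 : ℝ) := Finset.sum_le_sum fun _ _ => h1 _
    _ = _ := by simp

lemma almost_periods {X D D' W : Finset G} (hXD : X ⊆ D) (hXne : X.Nonempty) (hD' : D'.Nonempty)
    (φ : G → ℝ) (h0 : ∀ x, 0 ≤ φ x) (h1 : ∀ x, φ x ≤ 1)
    (ξ : ℝ) (hξ : 0 < ξ) (hX : ξ * D.card ≤ X.card)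
    (hDW : ∀ u ∈ D, ∀ t ∈ D', u + t ∈ W) (hW : (W.card : ℝ) ≤ 2 * D.card)
    (n : ℕ) (ε θ : ℝ) (hε : 0 < ε) (hθ : 4 * Real.exp (-(n * ε ^ 2 / 2)) ≤ θ) (hn : 0 < n) :
    ∃ T ⊆ D', (ξ / 2) ^ n / 2 * D'.card ≤ T.card ∧
      ∀ t ∈ T, ∀ t' ∈ T, ∀ s, (∀ u ∈ D, u + s ∈ W) → (∀ u ∈ D, u + s + t - t' ∈ W) →
        ∑ u ∈ X, |avX X φ (u + s + t - t') - avX X φ (u + s)| ≤ (2 * ε + 4 * θ / ξ) * X.card := by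
  set F := avX X φ with hF
  have hXc : (0 : ℝ) < X.card := by exact_mod_cast hXne.card_pos
  have hD'c : (0 : ℝ) < D'.card := by exact_mod_cast hD'.card_pos
  have hnR : (0 : ℝ) < n := by exact_mod_cast hn
  have hθ0 : 0 < θ := lt_of_lt_of_le (by positivity) hθ
  have hWne : (0 : ℝ) < W.card := by
    obtain ⟨x, hx⟩ := hXne
    obtain ⟨t, ht⟩ := hD'
    exact_mod_cast Finset.card_pos.2 ⟨_, hDW x (hXD hx) t ht⟩
  set XN := Fintype.piFinset fun _ : Fin n => X with hXN
  have hXNc : (XN.card : ℝ) = (X.card : ℝ) ^ n := by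
    rw [hXN, Fintype.card_piFinset]; simp
  -- exceptional sets
  set Ex : (Fin n → G) → Finset G :=
    fun a => W.filter (fun y => ε * n < |∑ i, (φ (y - a i) - F y)|) with hEx
  have htail : ∀ y, ((XN.filter (fun a => ε * n < |∑ i, (φ (y - a i) - F y)|)).card : ℝ) ≤
      2 * Real.exp (-(n * ε ^ 2 / 2)) * (X.card : ℝ) ^ n := by
    intro y
    refine tail_two X (fun x => φ (y - x) - F y) ?_ ?_ n ε hε
    · intro x _
      have := avX_mem X φ h0 h1 y
      have := h0 (y - x); have := h1 (y - x)
      rw [abs_le]; constructor <;> linarith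
    · rw [Finset.sum_sub_distrib, hF]; unfold avX; simp; field_simp; simp
  have hdc : ∑ a ∈ XN, ((Ex a).card : ℝ) ≤
      W.card * (2 * Real.exp (-(n * ε ^ 2 / 2)) * (X.card : ℝ) ^ n) := by
    have e : ∑ a ∈ XN, ((Ex a).card : ℝ) = ∑ y ∈ W,
        ((XN.filter (fun a => ε * n < |∑ i, (φ (y - a i) - F y)|)).card : ℝ) := by
      simp_rw [hEx, Finset.card_filter, Nat.cast_sum]
      rw [Finset.sum_comm]
    rw [e]
    calc _ ≤ ∑ y ∈ W, (2 * Real.exp (-(n * ε ^ 2 / 2)) * (X.card : ℝ) ^ n) :=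
          Finset.sum_le_sum fun y _ => htail y
      _ = _ := by simp
  set L := XN.filter (fun a => ((Ex a).card : ℝ) ≤ θ * W.card) with hL
  have hLc : (X.card : ℝ) ^ n / 2 ≤ L.card := by
    have a1 : ((XN.filter (fun a => ¬ ((Ex a).card : ℝ) ≤ θ * W.card)).card : ℝ) * (θ * W.card) ≤
        ∑ a ∈ XN, ((Ex a).card : ℝ) := by
      calc _ = ∑ a ∈ XN.filter (fun a => ¬ ((Ex a).card : ℝ) ≤ θ * W.card), (θ * W.card) := by
            rw [Finset.sum_const, nsmul_eq_mul]
        _ ≤ ∑ a ∈ XN.filter (fun a => ¬ ((Ex a).card : ℝ) ≤ θ * W.card), ((Ex a).card : ℝ) := by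
            refine Finset.sum_le_sum fun a ha => ?_
            have := (Finset.mem_filter.1 ha).2
            linarith
        _ ≤ _ := Finset.sum_le_sum_of_subset_of_nonneg (Finset.filter_subset _ _)
          fun _ _ _ => by positivity
    have a2 := Finset.card_filter_add_card_filter_not (s := XN)
      (fun a => ((Ex a).card : ℝ) ≤ θ * W.card)
    have a3 : ((L.card : ℝ)) + ((XN.filter (fun a => ¬ ((Ex a).card : ℝ) ≤ θ * W.card)).card : ℝ) =
        (X.card : ℝ) ^ n := by
      rw [← hXNc, ← a2]; push_cast; rfl
    set R := ((XN.filter (fun a => ¬ ((Ex a).card : ℝ) ≤ θ * W.card)).card : ℝ)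
    have a4 : R * (θ * W.card) ≤ (X.card : ℝ) ^ n / 2 * (θ * W.card) := by
      refine (a1.trans hdc).trans ?_
      have : 2 * Real.exp (-(n * ε ^ 2 / 2)) ≤ θ / 2 := by linarith
      calc _ ≤ W.card * (θ / 2 * (X.card : ℝ) ^ n) := by gcongr
        _ = _ := by ring
    have a5 := le_of_mul_le_mul_right a4 (by positivity)
    linarith
  -- pigeonhole
  set WN := Fintype.piFinset fun _ : Fin n => W with hWN
  have hWNc : (WN.card : ℝ) = (W.card : ℝ) ^ n := by
    rw [hWN, Fintype.card_piFinset]; simp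
  set Tb : (Fin n → G) → Finset G := fun b => D'.filter (fun t => (fun i => b i - t) ∈ L) with hTb
  have hcount : ∑ b ∈ WN, ((Tb b).card : ℝ) = D'.card * L.card := by
    have e : ∑ b ∈ WN, ((Tb b).card : ℝ) = ∑ t ∈ D',
        ((WN.filter (fun b => (fun i => b i - t) ∈ L)).card : ℝ) := by
      simp_rw [hTb, Finset.card_filter, Nat.cast_sum]
      rw [Finset.sum_comm]
    rw [e]
    have : ∀ t ∈ D', ((WN.filter (fun b => (fun i => b i - t) ∈ L)).card : ℝ) = L.card := by
      intro t ht
      congr 1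
      refine Finset.card_bij' (fun b _ => fun i => b i - t) (fun a _ => fun i => a i + t) ?_ ?_ ?_ ?_
      · intro b hb; exact (Finset.mem_filter.1 hb).2
      · intro a ha
        rw [Finset.mem_filter]
        refine ⟨?_, by simpa using ha⟩
        rw [hWN, Fintype.mem_piFinset]
        intro i
        have := (Finset.mem_filter.1 ha).1
        rw [hXN, Fintype.mem_piFinset] at this
        exact hDW _ (hXD (this i)) t ht
      · intro b _; simp
      · intro a _; simp
    rw [Finset.sum_congr rfl this]; simp
  obtain ⟨b, hb, hbT⟩ : ∃ b ∈ WN, (ξ / 2) ^ n / 2 * D'.card ≤ ((Tb b).card : ℝ) := by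
    by_contra hcon
    push Not at hcon
    have hWNne : WN.Nonempty := by
      rw [← Finset.card_pos]; 
      have : (0 : ℝ) < WN.card := by rw [hWNc]; positivity
      exact_mod_cast this
    have c1 := Finset.sum_lt_sum_of_nonempty hWNne hcon
    rw [hcount, Finset.sum_const, nsmul_eq_mul, hWNc] at c1
    have c2 : (W.card : ℝ) * (ξ / 2) ≤ X.card := by nlinarith
    have c3 : (W.card : ℝ) ^ n * (ξ / 2) ^ n ≤ (X.card : ℝ) ^ n := by
      rw [← mul_pow]; gcongr
    have c4 : (W.card : ℝ) ^ n * ((ξ / 2) ^ n / 2 * D'.card) ≤ D'.card * L.card := by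
      calc _ = (W.card : ℝ) ^ n * (ξ / 2) ^ n / 2 * D'.card := by ring
        _ ≤ (X.card : ℝ) ^ n / 2 * D'.card := by gcongr
        _ ≤ L.card * D'.card := by gcongr
        _ = _ := by ring
    linarith
  refine ⟨Tb b, Finset.filter_subset _ _, hbT, ?_⟩
  have hgood : ∀ t ∈ Tb b, ∀ y ∈ W, y ∉ Ex (fun i => b i - t) →
      |∑ i, φ (y + t - b i) / n - F y| ≤ ε := by
    intro t ht y hy hne
    have : ¬ (ε * n < |∑ i, (φ (y - (b i - t)) - F y)|) := fun h =>
      hne (Finset.mem_filter.2 ⟨hy, h⟩)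
    push Not at this
    have e : ∑ i, φ (y + t - b i) / n - F y = (∑ i, (φ (y - (b i - t)) - F y)) / n := by
      rw [Finset.sum_sub_distrib, sub_div, Finset.sum_div]
      simp only [Finset.sum_const, Finset.card_univ, Fintype.card_fin, nsmul_eq_mul]
      rw [mul_div_cancel_left₀ _ hnR.ne']
      congr 1
      refine Finset.sum_congr rfl fun i _ => ?_
      congr 2; abel
    rw [e, abs_div, abs_of_pos hnR, div_le_iff₀ hnR]
    exact this
  have hExc : ∀ t ∈ Tb b, ((Ex (fun i => b i - t)).card : ℝ) ≤ θ * W.card := by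
    intro t ht
    exact (Finset.mem_filter.1 (Finset.mem_filter.1 ht).2).2
  intro t ht t' ht' s hs1 hs2
  have hpt : ∀ u ∈ X, |F (u + s + t - t') - F (u + s)| ≤ 2 * ε +
      (ind (Ex (fun i => b i - t)) (u + s) + ind (Ex (fun i => b i - t')) (u + (s + t - t'))) := by
    intro u hu
    rw [show u + (s + t - t') = u + s + t - t' by abel]
    by_cases c1 : u + s ∈ Ex (fun i => b i - t)
    · have m1 := avX_mem X φ h0 h1 (u + s + t - t')
      have m2 := avX_mem X φ h0 h1 (u + s)
      have i1 : ind (Ex (fun i => b i - t)) (u + s) = 1 := by unfold ind; rw [if_pos c1]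
      have i2 := ind_nonneg (Ex (fun i => b i - t')) (u + s + t - t')
      rw [abs_le]; constructor <;> linarith
    by_cases c2 : u + s + t - t' ∈ Ex (fun i => b i - t')
    · have m1 := avX_mem X φ h0 h1 (u + s + t - t')
      have m2 := avX_mem X φ h0 h1 (u + s)
      have i1 : ind (Ex (fun i => b i - t')) (u + s + t - t') = 1 := by unfold ind; rw [if_pos c2]
      have i2 := ind_nonneg (Ex (fun i => b i - t)) (u + s)
      rw [abs_le]; constructor <;> linarith
    have g1 := hgood t ht (u + s) (hs1 u (hXD hu)) c1
    have g2 := hgood t' ht' (u + s + t - t') (hs2 u (hXD hu)) c2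
    rw [sub_add_cancel] at g2
    have i1 := ind_nonneg (Ex (fun i => b i - t)) (u + s)
    have i2 := ind_nonneg (Ex (fun i => b i - t')) (u + s + t - t')
    rw [abs_le] at g1 g2 ⊢
    constructor <;> linarith [g1.1, g1.2, g2.1, g2.2]
  have hshift : ∀ (E : Finset G) (r : G), ∑ u ∈ X, ind E (u + r) ≤ E.card := by
    intro E r
    calc ∑ u ∈ X, ind E (u + r) ≤ ∑ u, ind E (u + r) :=
          Finset.sum_le_sum_of_subset_of_nonneg (Finset.subset_univ _) fun _ _ _ => ind_nonneg _ _
      _ = ∑ u, ind E u := Equiv.sum_comp (Equiv.addRight r) (ind E)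
      _ = _ := sum_ind E
  calc _ ≤ ∑ u ∈ X, (2 * ε + (ind (Ex (fun i => b i - t)) (u + s) +
        ind (Ex (fun i => b i - t')) (u + (s + t - t')))) := Finset.sum_le_sum hpt
    _ ≤ X.card * (2 * ε) + (θ * W.card + θ * W.card) := by
        rw [Finset.sum_add_distrib, Finset.sum_add_distrib, Finset.sum_const, nsmul_eq_mul]
        have := (hshift _ s).trans (hExc t ht)
        have := (hshift _ (s + t - t')).trans (hExc t' ht')
        linarith
    _ ≤ _ := by
        have w1 : (W.card : ℝ) ≤ 2 * (X.card / ξ) := by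
          refine hW.trans ?_
          have : (D.card : ℝ) ≤ X.card / ξ := by rw [le_div_iff₀ hξ]; linarith
          linarith
        have w2 : θ * W.card + θ * W.card ≤ 4 * θ / ξ * X.card := by
          calc _ = 2 * θ * W.card := by ring
            _ ≤ 2 * θ * (2 * (X.card / ξ)) := by gcongr
            _ = _ := by ring
        linarith

/-- averaging operator over `T - T` -/
noncomputable def avT (T : Finset G) (F : G → ℝ) (x : G) : ℝ :=
  (∑ t ∈ T, ∑ t' ∈ T, F (x + t - t')) / (T.card : ℝ) ^ 2

lemma avT_mono (T : Finset G) {F F' : G → ℝ} (h : ∀ x, F x ≤ F' x) (x : G) :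
    avT T F x ≤ avT T F' x := by
  unfold avT; gcongr; exact h _

lemma avT_iter_mono (T : Finset G) {F F' : G → ℝ} (h : ∀ x, F x ≤ F' x) (k : ℕ) (x : G) :
    (avT T)^[k] F x ≤ (avT T)^[k] F' x := by
  induction k generalizing x with
  | zero => exact h x
  | succ k ih =>
    rw [Function.iterate_succ_apply', Function.iterate_succ_apply']
    exact avT_mono T ih x

lemma iter_almost {X T : Finset G} (hT : T.Nonempty) (F : G → ℝ) (η : ℝ)
    (N : ℕ → G → Prop) (hN : ∀ j s, N (j + 1) s → ∀ t ∈ T, ∀ t' ∈ T, N j (s + t - t'))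
    (h : ∀ j s, N (j + 1) s → ∀ t ∈ T, ∀ t' ∈ T,
      ∑ u ∈ X, |F (u + s + t - t') - F (u + s)| ≤ η * X.card) (j : ℕ) :
    ∀ s, N j s → ∑ u ∈ X, F (u + s) - j * η * X.card ≤ ∑ u ∈ X, (avT T)^[j] F (u + s) := by
  induction j with
  | zero => intro s _; simp
  | succ j ih =>
    intro s hs
    have hTc : (0 : ℝ) < (T.card : ℝ) ^ 2 := by
      have : (0 : ℝ) < T.card := by exact_mod_cast hT.card_pos
      positivity
    simp_rw [Function.iterate_succ_apply']
    have e : ∑ u ∈ X, avT T ((avT T)^[j] F) (u + s) =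
        (∑ t ∈ T, ∑ t' ∈ T, ∑ u ∈ X, (avT T)^[j] F (u + (s + t - t'))) / (T.card : ℝ) ^ 2 := by
      unfold avT
      rw [← Finset.sum_div]
      congr 1
      rw [Finset.sum_comm]
      refine Finset.sum_congr rfl fun t _ => ?_
      rw [Finset.sum_comm]
      refine Finset.sum_congr rfl fun t' _ => Finset.sum_congr rfl fun u _ => ?_
      rw [show u + (s + t - t') = u + s + t - t' by abel]
    rw [e, le_div_iff₀ hTc]
    have key : ∀ t ∈ T, ∀ t' ∈ T, ∑ u ∈ X, F (u + s) - ((j + 1 : ℕ) : ℝ) * η * X.card ≤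
        ∑ u ∈ X, (avT T)^[j] F (u + (s + t - t')) := by
      intro t ht t' ht'
      refine le_trans ?_ (ih _ (hN j s hs t ht t' ht'))
      have h2 := h j s hs t ht t' ht'
      have h3 : ∑ u ∈ X, F (u + s) - ∑ u ∈ X, F (u + (s + t - t')) ≤
          ∑ u ∈ X, |F (u + s + t - t') - F (u + s)| := by
        rw [← Finset.sum_sub_distrib]
        refine Finset.sum_le_sum fun u _ => ?_
        rw [show u + (s + t - t') = u + s + t - t' by abel, abs_sub_comm]
        exact le_abs_self _
      push_cast
      linarith
    calc _ = ∑ t ∈ T, ∑ t' ∈ T, (∑ u ∈ X, F (u + s) - ((j + 1 : ℕ) : ℝ) * η * X.card) := by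
          simp only [Finset.sum_const, nsmul_eq_mul]; ring
      _ ≤ _ := Finset.sum_le_sum fun t ht => Finset.sum_le_sum fun t' ht' => key t ht t' ht'
end KM

namespace KM
open Finset
set_option linter.unusedSectionVars false
variable {G : Type*} [AddCommGroup G] [Fintype G] [DecidableEq G]

/-- normalised Fourier transform of a set -/
noncomputable def hat (X : Finset G) (γ : AddChar G ℂ) : ℂ := (∑ x ∈ X, γ x) / X.card

lemma hat_norm_le (X : Finset G) (γ : AddChar G ℂ) : ‖hat X γ‖ ≤ 1 := by
  unfold hat
  rw [norm_div, Complex.norm_natCast]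
  refine div_le_one_of_le₀ ?_ (Nat.cast_nonneg _)
  refine (norm_sum_le _ _).trans ?_
  simp [AddChar.norm_apply]

lemma corr_fourier (A : Finset G) : ∃ c : AddChar G ℂ → ℝ, (∀ γ, 0 ≤ c γ) ∧
    ∀ x, (corr (ind A) x : ℂ) = ∑ γ : AddChar G ℂ, (c γ : ℂ) * γ x := by
  have hG : (Fintype.card G : ℂ) ≠ 0 := by
    exact_mod_cast Fintype.card_ne_zero
  refine ⟨fun γ => ‖∑ a ∈ A, γ a‖ ^ 2 / Fintype.card G, fun γ => by positivity, fun x => ?_⟩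
  have h1 : ∀ γ : AddChar G ℂ, ((‖∑ a ∈ A, γ a‖ ^ 2 / Fintype.card G : ℝ) : ℂ) * γ x =
      (∑ a ∈ A, ∑ b ∈ A, γ (a - b + x)) / Fintype.card G := by
    intro γ
    push_cast
    rw [← Complex.mul_conj', map_sum, Finset.sum_mul_sum, div_mul_eq_mul_div, Finset.sum_mul]
    congr 1
    refine Finset.sum_congr rfl fun a _ => ?_
    rw [Finset.sum_mul]
    refine Finset.sum_congr rfl fun b _ => ?_
    rw [sub_eq_add_neg, AddChar.map_add_eq_mul, AddChar.map_add_eq_mul, AddChar.map_neg_eq_conj]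
  rw [Finset.sum_congr rfl fun γ _ => h1 γ, ← Finset.sum_div, Finset.sum_comm]
  have h2 : ∀ a ∈ A, ∑ γ : AddChar G ℂ, ∑ b ∈ A, γ (a - b + x) =
      (Fintype.card G : ℂ) * (ind A (a + x) : ℝ) := by
    intro a _
    rw [Finset.sum_comm]
    simp_rw [AddChar.sum_apply_eq_ite]
    have : ∀ b, (a - b + x = 0) ↔ (b = a + x) := by
      intro b
      constructor
      · intro h
        have : a + x = (a - b + x) + b := by abel
        rw [this, h, zero_add]
      · rintro rfl; abel
    simp only [this, Finset.sum_ite_eq', ind]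
    split_ifs <;> simp
  rw [Finset.sum_congr rfl h2, ← Finset.mul_sum, mul_div_cancel_left₀ _ hG]
  have h3 : corr (ind A) x = ∑ a ∈ A, ind A (a + x) := by
    unfold corr
    have : ∀ y, ind A y * ind A (y + x) = if y ∈ A then ind A (y + x) else 0 := by
      intro y
      by_cases hy : y ∈ A <;> simp [ind, hy]
    simp only [this]
    simp
  rw [h3]
  push_cast
  rfl

lemma avX_fourier (X : Finset G) (F : G → ℝ) (c : AddChar G ℂ → ℂ)
    (h : ∀ x, (F x : ℂ) = ∑ γ, c γ * γ x) (x : G) :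
    (avX X F x : ℂ) = ∑ γ, (c γ * (starRingEnd ℂ) (hat X γ)) * γ x := by
  unfold avX
  push_cast
  simp_rw [h]
  rw [Finset.sum_comm, Finset.sum_div]
  refine Finset.sum_congr rfl fun γ _ => ?_
  unfold hat
  rw [map_div₀, map_sum, ← Finset.mul_sum]
  simp only [map_natCast]
  simp_rw [sub_eq_add_neg, AddChar.map_add_eq_mul, AddChar.map_neg_eq_conj]
  rw [← Finset.mul_sum]
  ring

lemma avT_fourier (T : Finset G) (F : G → ℝ) (c : AddChar G ℂ → ℂ)
    (h : ∀ x, (F x : ℂ) = ∑ γ, c γ * γ x) (x : G) :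
    (avT T F x : ℂ) = ∑ γ, (c γ * (‖hat T γ‖ : ℂ) ^ 2) * γ x := by
  unfold avT
  push_cast
  simp_rw [h]
  have : ∀ t ∈ T, ∑ t' ∈ T, ∑ γ : AddChar G ℂ, c γ * γ (x + t - t') =
      ∑ γ : AddChar G ℂ, ∑ t' ∈ T, c γ * γ (x + t - t') := fun t _ => Finset.sum_comm
  rw [Finset.sum_congr rfl this, Finset.sum_comm, Finset.sum_div]
  refine Finset.sum_congr rfl fun γ _ => ?_
  rw [← Complex.mul_conj']
  unfold hat
  rw [map_div₀, map_sum]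
  simp only [map_natCast]
  simp_rw [sub_eq_add_neg, AddChar.map_add_eq_mul, AddChar.map_neg_eq_conj, ← Finset.mul_sum]
  simp_rw [← Finset.sum_mul, ← Finset.mul_sum]
  ring

lemma avT_iter_fourier (T : Finset G) (F : G → ℝ) (c : AddChar G ℂ → ℂ)
    (h : ∀ x, (F x : ℂ) = ∑ γ, c γ * γ x) (k : ℕ) (x : G) :
    ((avT T)^[k] F x : ℂ) = ∑ γ, (c γ * (‖hat T γ‖ : ℂ) ^ (2 * k)) * γ x := by
  induction k generalizing x with
  | zero => simpa using h x
  | succ k ih =>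
    rw [Function.iterate_succ_apply', avT_fourier T _ _ ih]
    refine Finset.sum_congr rfl fun γ _ => ?_
    ring

lemma avg_fourier (X T : Finset G) (hX : X.Nonempty) (F : G → ℝ) (c : AddChar G ℂ → ℂ)
    (h : ∀ x, (F x : ℂ) = ∑ γ, c γ * γ x) (k : ℕ) :
    ((∑ u ∈ X, (avT T)^[k] (avX X F) u : ℝ) : ℂ) =
      X.card * ∑ γ, c γ * ((‖hat T γ‖ ^ (2 * k) * ‖hat X γ‖ ^ 2 : ℝ) : ℂ) := by
  have hXc : (X.card : ℂ) ≠ 0 := by exact_mod_cast hX.card_pos.ne'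
  push_cast
  rw [Finset.sum_congr rfl fun u _ => avT_iter_fourier T _ _ (avX_fourier X F c h) k u]
  rw [Finset.sum_comm, Finset.mul_sum]
  refine Finset.sum_congr rfl fun γ _ => ?_
  rw [← Finset.mul_sum]
  have : ∑ u ∈ X, γ u = X.card * hat X γ := by
    unfold hat; field_simp
  rw [this, ← Complex.conj_mul' (hat X γ)]
  ring

lemma avT_le_const (T : Finset G) (F : G → ℝ) {K : ℝ} (hT : T.Nonempty) (h : ∀ x, F x ≤ K) (x : G) :
    avT T F x ≤ K := by
  have hTc : (0 : ℝ) < (T.card : ℝ) ^ 2 := by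
    have : (0 : ℝ) < T.card := by exact_mod_cast hT.card_pos
    positivity
  unfold avT
  rw [div_le_iff₀ hTc]
  calc _ ≤ ∑ t ∈ T, ∑ t' ∈ T, K := Finset.sum_le_sum fun t _ => Finset.sum_le_sum fun t' _ => h _
    _ = _ := by simp; ring

lemma avT_iter_le_const (T : Finset G) (F : G → ℝ) {K : ℝ} (hT : T.Nonempty) (h : ∀ x, F x ≤ K)
    (k : ℕ) (x : G) : (avT T)^[k] F x ≤ K := by
  induction k generalizing x with
  | zero => exact h x
  | succ k ih => rw [Function.iterate_succ_apply']; exact avT_le_const T _ hT ih x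

lemma avX_le_const (X : Finset G) (F : G → ℝ) {K : ℝ} (hX : X.Nonempty) (h : ∀ x, F x ≤ K) (x : G) :
    avX X F x ≤ K := by
  have hXc : (0 : ℝ) < X.card := by exact_mod_cast hX.card_pos
  unfold avX
  rw [div_le_iff₀ hXc]
  calc _ ≤ ∑ t ∈ X, K := Finset.sum_le_sum fun t _ => h _
    _ = _ := by simp; ring

lemma spec_increment {A X T B : Finset G} (hA : A.Nonempty) (hX : X.Nonempty) (hT : T.Nonempty)
    (k : ℕ) (L : ℝ)
    (hL : L * X.card ≤ ∑ u ∈ X, (avT T)^[k] (avX X (corr (ind A))) u)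
    (hB : ∀ γ : AddChar G ℂ, 1 / 2 ≤ ‖hat T γ‖ → ∀ b ∈ B, ‖γ b - 1‖ ≤ 0.004) :
    ∃ z, (0.996 * L - 2 * (1 / 4) ^ k * A.card) * B.card ≤
      A.card * ((B.filter fun b => b + z ∈ A).card : ℝ) := by
  obtain ⟨c, hc, hF⟩ := corr_fourier A
  have hXc : (0 : ℝ) < X.card := by exact_mod_cast hX.card_pos
  set w : AddChar G ℂ → ℝ := fun γ => c γ * (‖hat T γ‖ ^ (2 * k) * ‖hat X γ‖ ^ 2) with hw
  have hw0 : ∀ γ, 0 ≤ w γ := fun γ => mul_nonneg (hc γ) (by positivity)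
  -- total mass of c
  have hsum : ∑ γ, c γ = A.card := by
    have h0 := hF 0
    simp only [AddChar.map_zero_eq_one, mul_one] at h0
    have h1 : corr (ind A) 0 = A.card := by
      unfold corr ind; simp
    rw [h1] at h0
    exact_mod_cast h0.symm
  -- base sum
  have hbase : L ≤ ∑ γ, w γ := by
    have h := avg_fourier X T hX (corr (ind A)) (fun γ => (c γ : ℂ)) hF k
    have h' : ∑ u ∈ X, (avT T)^[k] (avX X (corr (ind A))) u = X.card * ∑ γ, w γ := by
      have : ((∑ u ∈ X, (avT T)^[k] (avX X (corr (ind A))) u : ℝ) : ℂ) =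
        ((X.card * ∑ γ, w γ : ℝ) : ℂ) := by rw [h, hw]; push_cast; rfl
      exact_mod_cast this
    rw [h'] at hL
    nlinarith
  -- shifted sum
  set H : G → ℝ := fun x => ∑ b ∈ B, corr (ind A) (x + b) with hH
  have hHF : ∀ x, (H x : ℂ) = ∑ γ, (c γ * ∑ b ∈ B, γ b) * γ x := by
    intro x
    rw [hH]
    push_cast
    rw [Finset.sum_congr rfl fun b _ => hF (x + b), Finset.sum_comm]
    refine Finset.sum_congr rfl fun γ _ => ?_
    rw [← Finset.mul_sum, mul_assoc, Finset.sum_mul]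
    congr 1
    refine Finset.sum_congr rfl fun b _ => ?_
    rw [AddChar.map_add_eq_mul]; ring
  have hHs : ∑ u ∈ X, (avT T)^[k] (avX X H) u = X.card * ∑ γ, w γ * (∑ b ∈ B, γ b).re := by
    have h := avg_fourier X T hX H _ hHF k
    have h2 := congrArg Complex.re h
    rw [Complex.ofReal_re] at h2
    rw [h2, ← Complex.ofReal_natCast, Complex.re_ofReal_mul, Complex.re_sum]
    congr 1
    refine Finset.sum_congr rfl fun γ _ => ?_
    rw [mul_assoc, Complex.re_ofReal_mul, Complex.re_mul_ofReal, hw]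
    ring
  -- lower bound for each γ
  have hterm : ∀ γ, (0.996 * w γ - 2 * (1 / 4) ^ k * c γ) * B.card ≤ w γ * (∑ b ∈ B, γ b).re := by
    intro γ
    by_cases hs : 1 / 2 ≤ ‖hat T γ‖
    · have h1 : (0.996 : ℝ) * B.card ≤ (∑ b ∈ B, γ b).re := by
        rw [Complex.re_sum]
        calc (0.996 : ℝ) * B.card = ∑ b ∈ B, (0.996 : ℝ) := by simp; ring
          _ ≤ _ := Finset.sum_le_sum fun b hb => by
            have h2 := (Complex.abs_re_le_norm _).trans (hB γ hs b hb)
            rw [Complex.sub_re, Complex.one_re] at h2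
            linarith [(abs_le.mp h2).1]
      have h3 : 0 ≤ 2 * (1 / 4 : ℝ) ^ k * c γ * B.card :=
        mul_nonneg (mul_nonneg (by positivity) (hc γ)) (Nat.cast_nonneg _)
      nlinarith [mul_le_mul_of_nonneg_left h1 (hw0 γ)]
    · push Not at hs
      have h1 : -(B.card : ℝ) ≤ (∑ b ∈ B, γ b).re := by
        have : ‖∑ b ∈ B, γ b‖ ≤ B.card := by
          refine (norm_sum_le _ _).trans ?_
          simp [AddChar.norm_apply]
        linarith [(abs_le.mp ((Complex.abs_re_le_norm _).trans this)).1]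
      have h2 : w γ ≤ (1 / 4) ^ k * c γ := by
        show c γ * _ ≤ _
        rw [mul_comm (c γ)]
        refine mul_le_mul_of_nonneg_right ?_ (hc γ)
        have e1 : ‖hat T γ‖ ^ (2 * k) ≤ (1 / 4) ^ k := by
          rw [pow_mul]
          refine pow_le_pow_left₀ (by positivity) ?_ k
          nlinarith [norm_nonneg (hat T γ)]
        have e2 : ‖hat X γ‖ ^ 2 ≤ 1 := pow_le_one₀ (norm_nonneg _) (hat_norm_le X γ)
        calc _ ≤ (1 / 4 : ℝ) ^ k * 1 := mul_le_mul e1 e2 (by positivity) (by positivity)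
          _ = _ := mul_one _
      have h3 := mul_le_mul_of_nonneg_left h1 (hw0 γ)
      have h4 := mul_le_mul_of_nonneg_right h2 (Nat.cast_nonneg (α := ℝ) B.card)
      have h5 := mul_nonneg (hw0 γ) (Nat.cast_nonneg (α := ℝ) B.card)
      nlinarith
  have hlow : (0.996 * L - 2 * (1 / 4) ^ k * A.card) * B.card * X.card ≤
      ∑ u ∈ X, (avT T)^[k] (avX X H) u := by
    rw [hHs]
    have h1 := Finset.sum_le_sum fun γ (_ : γ ∈ univ) => hterm γ
    rw [← Finset.sum_mul, Finset.sum_sub_distrib, ← Finset.mul_sum, ← Finset.mul_sum, hsum] at h1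
    have h2 : (0.996 * L - 2 * (1 / 4) ^ k * A.card) * B.card ≤
        (0.996 * ∑ γ, w γ - 2 * (1 / 4) ^ k * A.card) * B.card := by
      gcongr
    nlinarith [mul_le_mul_of_nonneg_right (h2.trans h1) hXc.le]
  by_contra hcon
  push Not at hcon
  have hcard : ∀ x, H x < (0.996 * L - 2 * (1 / 4) ^ k * A.card) * B.card := by
    intro x
    have e : H x = ∑ y ∈ A, ((B.filter fun b => b + (y + x) ∈ A).card : ℝ) := by
      rw [hH]
      simp only [corr]
      rw [Finset.sum_comm]
      have : ∀ y, ∑ b ∈ B, ind A y * ind A (y + (x + b)) =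
          if y ∈ A then ((B.filter fun b => b + (y + x) ∈ A).card : ℝ) else 0 := by
        intro y
        rw [← Finset.mul_sum]
        unfold ind
        rw [Finset.sum_boole]
        split_ifs with hy
        · rw [one_mul]; congr 2; refine Finset.filter_congr fun b _ => ?_
          rw [show b + (y + x) = y + (x + b) by abel]
        · simp
      simp only [this]
      simp
    rw [e]
    have hAc : (0 : ℝ) < A.card := by exact_mod_cast hA.card_pos
    have h1 : A.card * ∑ y ∈ A, ((B.filter fun b => b + (y + x) ∈ A).card : ℝ) <
        A.card * ((0.996 * L - 2 * (1 / 4) ^ k * A.card) * B.card) := by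
      rw [Finset.mul_sum]
      calc _ < ∑ y ∈ A, (0.996 * L - 2 * (1 / 4) ^ k * A.card) * (B.card : ℝ) :=
            Finset.sum_lt_sum_of_nonempty hA fun y _ => hcon _
        _ = _ := by simp
    exact lt_of_mul_lt_mul_left h1 hAc.le
  obtain ⟨x0, -, hx0⟩ := Finset.exists_max_image univ H ⟨0, mem_univ _⟩
  have hup : ∑ u ∈ X, (avT T)^[k] (avX X H) u ≤ X.card * H x0 := by
    calc _ ≤ ∑ u ∈ X, H x0 := Finset.sum_le_sum fun u _ =>
          avT_iter_le_const T _ hT (avX_le_const X H hX fun x => hx0 x (mem_univ _)) k u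
      _ = _ := by simp
  nlinarith [hcard x0]
end KM

namespace KM
open Finset
set_option linter.unusedSectionVars false
variable {G : Type*} [AddCommGroup G] [Fintype G] [DecidableEq G]

/-- coefficients in `{-1,0,1}` -/
def Sgn {ι : Type*} (ε : ι → ℤ) : Prop := ∀ i, ε i = -1 ∨ ε i = 0 ∨ ε i = 1

/-- Riesz product -/
noncomputable def riesz (c : AddChar G ℂ → ℂ) (Λ : Finset (AddChar G ℂ)) (x : G) : ℝ :=
  ∏ l ∈ Λ, (1 + (c l * l x).re)

lemma re_expand (c : ℂ) (l : AddChar G ℂ) (x : G) :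
    (((1 + (c * l x).re : ℝ)) : ℂ) = 1 + c / 2 * l x + (starRingEnd ℂ) c / 2 * (-l) x := by
  rw [AddChar.neg_apply, AddChar.map_neg_eq_conj]
  have := Complex.add_conj (c * l x)
  rw [map_mul] at this
  push_cast at this ⊢
  linear_combination (-1 / 2 : ℂ) * this

lemma riesz_insert (c : AddChar G ℂ → ℂ) {Λ : Finset (AddChar G ℂ)} {l : AddChar G ℂ} (hl : l ∉ Λ)
    (ψ : AddChar G ℂ) :
    (fun x => ψ x * (riesz c (insert l Λ) x : ℂ)) = (fun x => ψ x * (riesz c Λ x : ℂ)) +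
      (c l / 2) • (fun x => (ψ + l) x * (riesz c Λ x : ℂ)) +
      ((starRingEnd ℂ) (c l) / 2) • (fun x => (ψ + -l) x * (riesz c Λ x : ℂ)) := by
  funext x
  simp only [Pi.add_apply, Pi.smul_apply, smul_eq_mul, AddChar.add_apply]
  unfold riesz
  rw [Finset.prod_insert hl, Complex.ofReal_mul, re_expand]
  ring

lemma norm_half (z : ℂ) (hz : ‖z‖ ≤ 1) : ‖z / 2‖ ≤ 1 / 2 := by
  rw [norm_div]; norm_num; linarith

lemma riesz_bound (L : (G → ℂ) →ₗ[ℂ] ℂ) (c : AddChar G ℂ → ℂ) (hc : ∀ l, ‖c l‖ ≤ 1) (δ : ℝ)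
    (Λ : Finset (AddChar G ℂ)) : ∀ ψ : AddChar G ℂ,
    (∀ ε : AddChar G ℂ → ℤ, Sgn ε → ‖L (fun x => (ψ + ∑ l ∈ Λ, ε l • l) x)‖ ≤ δ) →
    ‖L (fun x => ψ x * (riesz c Λ x : ℂ))‖ ≤ 2 ^ Λ.card * δ := by
  classical
  induction Λ using Finset.induction_on with
  | empty =>
    intro ψ h
    have := h (fun _ => 0) (fun _ => by simp)
    simpa [riesz] using this
  | insert l Λ hl ih =>
    intro ψ h
    have key : ∀ e : ℤ, (e = -1 ∨ e = 0 ∨ e = 1) →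
        ‖L (fun x => (ψ + e • l) x * (riesz c Λ x : ℂ))‖ ≤ 2 ^ Λ.card * δ := by
      intro e he
      refine ih (ψ + e • l) fun ε hε => ?_
      have h1 := h (Function.update ε l e) (by
        intro i
        by_cases hi : i = l
        · subst hi; simpa using he
        · simpa [Function.update_of_ne hi] using hε i)
      rw [Finset.sum_insert hl] at h1
      have h2 : ∑ i ∈ Λ, Function.update ε l e i • i = ∑ i ∈ Λ, ε i • i := by
        refine Finset.sum_congr rfl fun i hi => ?_
        rw [Function.update_of_ne (by rintro rfl; exact hl hi)]
      rw [h2, Function.update_self, ← add_assoc] at h1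
      exact h1
    have k0 := key 0 (by simp)
    have k1 := key 1 (by simp)
    have k2 := key (-1) (by simp)
    rw [zero_zsmul, add_zero] at k0
    rw [one_zsmul] at k1
    rw [neg_one_zsmul] at k2
    rw [riesz_insert c hl ψ, map_add, map_add, map_smul, map_smul, Finset.card_insert_of_notMem hl]
    refine (norm_add₃_le).trans ?_
    rw [norm_smul, norm_smul]
    have n1 := norm_half (c l) (hc l)
    have n2 := norm_half ((starRingEnd ℂ) (c l)) (by rw [RCLike.norm_conj]; exact hc l)
    have m1 := mul_le_mul n1 k1 (norm_nonneg _) (by norm_num)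
    have m2 := mul_le_mul n2 k2 (norm_nonneg _) (by norm_num)
    rw [pow_succ]
    linarith

lemma riesz_bound_one (L : (G → ℂ) →ₗ[ℂ] ℂ) (c : AddChar G ℂ → ℂ) (hc : ∀ l, ‖c l‖ ≤ 1) (δ : ℝ)
    (Λ : Finset (AddChar G ℂ)) 
    (h : ∀ ε : AddChar G ℂ → ℤ, Sgn ε → (∃ l ∈ Λ, ε l ≠ 0) →
      ‖L (fun x => (∑ l ∈ Λ, ε l • l) x)‖ ≤ δ) :
    ‖L (fun x => (riesz c Λ x : ℂ)) - L (fun _ => 1)‖ ≤ (2 ^ Λ.card - 1) * δ := by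
  classical
  induction Λ using Finset.induction_on with
  | empty => simp [riesz]
  | insert l Λ hl ih =>
    have upd : ∀ (ε : AddChar G ℂ → ℤ), Sgn ε → ∀ e : ℤ, (e = -1 ∨ e = 0 ∨ e = 1) →
        (e ≠ 0 ∨ ∃ l ∈ Λ, ε l ≠ 0) → ‖L (fun x => (e • l + ∑ l ∈ Λ, ε l • l) x)‖ ≤ δ := by
      intro ε hε e he hne
      have h1 := h (Function.update ε l e) (by
        intro i
        by_cases hi : i = l
        · subst hi; simpa using he
        · simpa [Function.update_of_ne hi] using hε i) (by
        rcases hne with hne | ⟨i, hi, hne⟩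
        · exact ⟨l, Finset.mem_insert_self _ _, by simpa using hne⟩
        · refine ⟨i, Finset.mem_insert_of_mem hi, ?_⟩
          rw [Function.update_of_ne (by rintro rfl; exact hl hi)]; exact hne)
      rw [Finset.sum_insert hl] at h1
      have h2 : ∑ i ∈ Λ, Function.update ε l e i • i = ∑ i ∈ Λ, ε i • i := by
        refine Finset.sum_congr rfl fun i hi => ?_
        rw [Function.update_of_ne (by rintro rfl; exact hl hi)]
      rw [h2, Function.update_self] at h1
      exact h1
    have k0 := ih (fun ε hε hne => by
      have := upd ε hε 0 (by simp) (Or.inr hne)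
      simpa using this)
    have k1 := riesz_bound L c hc δ Λ l (fun ε hε => by
      have := upd ε hε 1 (by simp) (Or.inl (by simp))
      simpa using this)
    have k2 := riesz_bound L c hc δ Λ (-l) (fun ε hε => by
      have := upd ε hε (-1) (by simp) (Or.inl (by simp))
      simpa using this)
    have e := riesz_insert c hl 0
    simp only [AddChar.zero_apply, one_mul, zero_add] at e
    rw [e, map_add, map_add, map_smul, map_smul, Finset.card_insert_of_notMem hl]
    have n1 := norm_half (c l) (hc l)
    have n2 := norm_half ((starRingEnd ℂ) (c l)) (by rw [RCLike.norm_conj]; exact hc l)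
    have m1 := mul_le_mul n1 k1 (norm_nonneg _) (by norm_num)
    have m2 := mul_le_mul n2 k2 (norm_nonneg _) (by norm_num)
    rw [← norm_smul] at m1 m2
    have tri : ∀ a b c d : ℂ, ‖a + b + c - d‖ ≤ ‖a - d‖ + ‖b‖ + ‖c‖ := by
      intro a b c d
      have : a + b + c - d = (a - d) + b + c := by ring
      rw [this]; exact norm_add₃_le
    refine (tri _ _ _ _).trans ?_
    rw [pow_succ]
    linarith

/-- averaging over shifts by `E`, as a linear map -/
noncomputable def avE (E : Finset G) : (G → ℂ) →ₗ[ℂ] (G → ℂ) where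
  toFun F := fun x => (∑ e ∈ E, F (x + e)) / E.card
  map_add' F F' := by
    funext x; simp [Finset.sum_add_distrib, add_div]
  map_smul' a F := by
    funext x; simp [← Finset.mul_sum, mul_div_assoc]

lemma avE_char (E : Finset G) (γ : AddChar G ℂ) (M : ℕ) :
    ((avE E) ^ M) (fun x => γ x) = (hat E γ) ^ M • (fun x => γ x) := by
  induction M with
  | zero => simp
  | succ M ih =>
    rw [pow_succ', Module.End.mul_apply, ih, map_smul, pow_succ, mul_smul]
    congr 1
    funext x
    simp only [avE, LinearMap.coe_mk, AddHom.coe_mk, Pi.smul_apply, smul_eq_mul, hat]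
    simp_rw [AddChar.map_add_eq_mul]
    rw [← Finset.mul_sum]; ring

open scoped ComplexOrder in
lemma avE_real (E : Finset G) (F : G → ℂ) (hF : ∀ x, 0 ≤ F x) (M : ℕ) (x : G) :
    0 ≤ ((avE E) ^ M) F x := by
  induction M generalizing x with
  | zero => simpa using hF x
  | succ M ih =>
    rw [pow_succ', Module.End.mul_apply]
    simp only [avE, LinearMap.coe_mk, AddHom.coe_mk]
    have : (0:ℂ) ≤ E.card := by exact_mod_cast Nat.zero_le _
    refine mul_nonneg (Finset.sum_nonneg fun e _ => ih _) (inv_nonneg_of_nonneg this)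

open scoped ComplexOrder in
lemma avE_chain (E : Finset G) (hE : E.Nonempty) (N : ℕ → Finset G)
    (hN : ∀ j, ∀ d ∈ N j, ∀ e ∈ E, d - e ∈ N (j + 1)) (F : G → ℂ) (hF : ∀ x, 0 ≤ F x) (M : ℕ) :
    ∑ x ∈ N 0, F x ≤ ∑ x ∈ N M, ((avE E) ^ M) F x := by
  induction M with
  | zero => simp
  | succ M ih =>
    refine ih.trans ?_
    have hEc : (E.card : ℂ) ≠ 0 := by exact_mod_cast hE.card_pos.ne'
    set H := ((avE E) ^ M) F with hH
    have hH0 : ∀ x, 0 ≤ H x := avE_real E F hF M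
    have e1 : ∑ x ∈ N (M + 1), ((avE E) ^ (M + 1)) F x =
        (∑ e ∈ E, ∑ x ∈ N (M + 1), H (x + e)) / E.card := by
      rw [pow_succ', Finset.sum_comm, Finset.sum_div]
      rfl
    have e2 : ∑ x ∈ N M, H x = (∑ e ∈ E, ∑ x ∈ N M, H x) / E.card := by
      rw [Finset.sum_const, nsmul_eq_mul, mul_div_cancel_left₀ _ hEc]
    rw [e1, e2, div_eq_mul_inv, div_eq_mul_inv]
    have : (0:ℂ) ≤ E.card := by exact_mod_cast Nat.zero_le _
    refine mul_le_mul_of_nonneg_right ?_ (inv_nonneg_of_nonneg this)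
    refine Finset.sum_le_sum fun e he => ?_
    have e3 : ∑ x ∈ N M, H x = ∑ y ∈ (N M).image (fun x => x - e), H (y + e) := by
      rw [Finset.sum_image (fun a _ b _ h => by simpa using h)]
      simp
    rw [e3]
    refine Finset.sum_le_sum_of_subset_of_nonneg ?_ (fun i _ _ => hH0 _)
    intro y hy
    rw [Finset.mem_image] at hy
    obtain ⟨d, hd, rfl⟩ := hy
    exact hN M d hd e he
end KM

namespace KM
open Finset
set_option linter.unusedSectionVars false
variable {G : Type*} [AddCommGroup G] [Fintype G] [DecidableEq G]

/-- dissociativity relative to `E` -/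
def Diss (E : Finset G) (Λ : Finset (AddChar G ℂ)) : Prop :=
  ∀ ε : AddChar G ℂ → ℤ, Sgn ε → (∃ l ∈ Λ, ε l ≠ 0) → ‖hat E (∑ l ∈ Λ, ε l • l)‖ ≤ 1 / 2

/-- averaging functional -/
noncomputable def avL (E W : Finset G) (M : ℕ) : (G → ℂ) →ₗ[ℂ] ℂ where
  toFun F := (∑ x ∈ W, ((avE E) ^ M) F x) / W.card
  map_add' F F' := by
    simp [Finset.sum_add_distrib, add_div]
  map_smul' a F := by
    simp [← Finset.mul_sum, mul_div_assoc]

lemma avL_char (E W : Finset G) (M : ℕ) (γ : AddChar G ℂ) :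
    avL E W M (fun x => γ x) = (hat E γ) ^ M * hat W γ := by
  simp only [avL, LinearMap.coe_mk, AddHom.coe_mk, avE_char, hat, Pi.smul_apply, smul_eq_mul]
  rw [← Finset.mul_sum]; ring

lemma hat_zero (E : Finset G) (hE : E.Nonempty) : hat E (0 : AddChar G ℂ) = 1 := by
  have hEc : (E.card : ℂ) ≠ 0 := by exact_mod_cast hE.card_pos.ne'
  simp [hat, hEc]

lemma riesz_nonneg (c : AddChar G ℂ → ℂ) (hc : ∀ l, ‖c l‖ ≤ 1) (Λ : Finset (AddChar G ℂ)) (x : G) :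
    0 ≤ riesz c Λ x := by
  unfold riesz
  refine Finset.prod_nonneg fun l _ => ?_
  have : ‖c l * l x‖ ≤ 1 := by rw [norm_mul, AddChar.norm_apply, mul_one]; exact hc l
  linarith [(abs_le.mp ((Complex.abs_re_le_norm _).trans this)).1]

open scoped ComplexOrder in
lemma riesz_sum {E : Finset G} (hE : E.Nonempty) (N : ℕ → Finset G)
    (hN : ∀ j, ∀ d ∈ N j, ∀ e ∈ E, d - e ∈ N (j + 1)) (M : ℕ) (hNM : (N M).Nonempty)
    (c : AddChar G ℂ → ℂ) (hc : ∀ l, ‖c l‖ ≤ 1) (Λ : Finset (AddChar G ℂ)) (hΛ : Diss E Λ)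
    (hcard : Λ.card ≤ M) : ∑ x ∈ N 0, riesz c Λ x ≤ 2 * (N M).card := by
  have hWc : (0 : ℝ) < (N M).card := by exact_mod_cast hNM.card_pos
  have h1 := riesz_bound_one (avL E (N M) M) c hc ((1 / 2) ^ M) Λ (by
    intro ε hε hne
    rw [avL_char, norm_mul, norm_pow]
    calc _ ≤ (1 / 2 : ℝ) ^ M * 1 := mul_le_mul
          (pow_le_pow_left₀ (norm_nonneg _) (hΛ ε hε hne) M) (hat_norm_le _ _)
          (norm_nonneg _) (by positivity)
      _ = _ := mul_one _)
  have h2 : avL E (N M) M (fun _ => 1) = 1 := by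
    have := avL_char E (N M) M 0
    simp only [AddChar.zero_apply] at this
    rw [this, hat_zero E hE, hat_zero _ hNM]; simp
  have h3 : ((2 : ℝ) ^ Λ.card - 1) * (1 / 2) ^ M ≤ 1 := by
    have : (2 : ℝ) ^ Λ.card ≤ 2 ^ M := pow_le_pow_right₀ (by norm_num) hcard
    calc _ ≤ (2 : ℝ) ^ M * (1 / 2) ^ M := by gcongr; linarith
      _ = 1 := by rw [← mul_pow]; norm_num
  rw [h2] at h1
  have h4 : ‖avL E (N M) M (fun x => (riesz c Λ x : ℂ))‖ ≤ 2 := by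
    calc _ = ‖(avL E (N M) M (fun x => (riesz c Λ x : ℂ)) - 1) + 1‖ := by ring_nf
      _ ≤ _ := norm_add_le _ _
      _ ≤ 2 := by rw [norm_one]; linarith
  have h5 := avE_chain E hE N hN (fun x => (riesz c Λ x : ℂ)) (fun x => by
    exact_mod_cast riesz_nonneg c hc Λ x) M
  have h6 : ∑ x ∈ N M, ((avE E) ^ M) (fun x => (riesz c Λ x : ℂ)) x =
      (N M).card * avL E (N M) M (fun x => (riesz c Λ x : ℂ)) := by
    have : ((N M).card : ℂ) ≠ 0 := by exact_mod_cast hWc.ne'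
    simp only [avL, LinearMap.coe_mk, AddHom.coe_mk]
    field_simp
  rw [h6] at h5
  have h7 := (Complex.le_def.mp h5).1
  have h8 : (∑ x ∈ N 0, (riesz c Λ x : ℂ)).re = ∑ x ∈ N 0, riesz c Λ x := by
    rw [Complex.re_sum]; simp
  rw [h8] at h7
  refine h7.trans ((Complex.re_le_norm _).trans ?_)
  rw [norm_mul, Complex.norm_natCast]
  nlinarith

lemma chang_card {E T : Finset G} (hE : E.Nonempty) (N : ℕ → Finset G)
    (hN : ∀ j, ∀ d ∈ N j, ∀ e ∈ E, d - e ∈ N (j + 1)) (M : ℕ)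
    (hTN : T ⊆ N 0) (hT : T.Nonempty) (τ : ℝ) (hτ : 0 < τ) (hTc : τ * (N 0).card ≤ T.card)
    (hM2 : ((N M).card : ℝ) ≤ 2 * (N 0).card) (hNM : (N M).Nonempty)
    (Λ : Finset (AddChar G ℂ)) (hΛ : Diss E Λ)
    (hcard : Λ.card ≤ M) (hspec : ∀ l ∈ Λ, 1 / 2 ≤ ‖hat T l‖) :
    (Λ.card : ℝ) ≤ 8 * Real.log (4 / τ) := by
  have hTc0 : (0 : ℝ) < T.card := by exact_mod_cast hT.card_pos
  set s : ℝ := Real.sinh (1 / 2) / Real.cosh (1 / 2) with hs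
  have hch : 0 < Real.cosh (1 / 2) := Real.cosh_pos _
  have hsh : 0 < Real.sinh (1 / 2) := Real.sinh_pos_iff.mpr (by norm_num)
  have hs0 : 0 ≤ s := by positivity
  have hs1 : s ≤ 1 := by
    rw [hs, div_le_one hch]; exact (Real.sinh_lt_cosh _).le
  set a : AddChar G ℂ → ℂ := fun l => (starRingEnd ℂ) (hat T l) / ‖hat T l‖ with ha
  have ha1 : ∀ l, ‖a l‖ ≤ 1 := by
    intro l
    rw [ha]
    simp only [norm_div, RCLike.norm_conj, Complex.norm_real, norm_norm]
    exact div_self_le_one _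
  set c : AddChar G ℂ → ℂ := fun l => (s : ℂ) * a l with hc
  have hc1 : ∀ l, ‖c l‖ ≤ 1 := by
    intro l
    rw [hc]
    simp only [norm_mul, Complex.norm_real, Real.norm_eq_abs, abs_of_nonneg hs0]
    nlinarith [ha1 l, norm_nonneg (a l)]
  set u : AddChar G ℂ → G → ℝ := fun l x => (a l * l x).re with hu
  have hu1 : ∀ l x, |u l x| ≤ 1 := by
    intro l x
    refine (Complex.abs_re_le_norm _).trans ?_
    rw [norm_mul, AddChar.norm_apply, mul_one]; exact ha1 l
  have hup := riesz_sum hE N hN M hNM c hc1 Λ hΛ hcard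
  -- pointwise
  have hpt : ∀ x, Real.exp (∑ l ∈ Λ, u l x * (1 / 2)) ≤ Real.cosh (1 / 2) ^ Λ.card * riesz c Λ x := by
    intro x
    rw [Real.exp_sum, riesz, ← Finset.prod_const, ← Finset.prod_mul_distrib]
    refine Finset.prod_le_prod (fun l _ => (Real.exp_pos _).le) fun l _ => ?_
    refine (Real.exp_mul_le_cosh_add_mul_sinh (hu1 l x) (1 / 2)).trans (le_of_eq ?_)
    have : (c l * l x).re = s * u l x := by
      rw [hc, hu]; simp only [mul_assoc, Complex.re_ofReal_mul]
    rw [this, hs]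
    field_simp
  have hmean : ∀ l ∈ Λ, (T.card : ℝ) / 2 ≤ ∑ x ∈ T, u l x := by
    intro l hl
    have h1 : ∑ x ∈ T, u l x = T.card * ‖hat T l‖ := by
      have hne : ((‖hat T l‖ : ℝ) : ℂ) ≠ 0 := by
        have := hspec l hl
        have : ‖hat T l‖ ≠ 0 := by linarith
        exact_mod_cast this
      have hTC : (T.card : ℂ) ≠ 0 := by exact_mod_cast hTc0.ne'
      have h2 : ∑ x ∈ T, a l * l x = ((T.card * ‖hat T l‖ : ℝ) : ℂ) := by
        rw [← Finset.mul_sum]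
        have h3 : ∑ x ∈ T, l x = T.card * hat T l := by unfold hat; field_simp
        rw [h3, ha]
        have h4 := Complex.conj_mul' (hat T l)
        push_cast
        field_simp
        linear_combination h4
      have h5 := congrArg Complex.re h2
      rw [Complex.re_sum, Complex.ofReal_re] at h5
      exact h5
    rw [h1]; nlinarith [hspec l hl]
  have hlow : (T.card : ℝ) * Real.exp (Λ.card / 4) ≤
      ∑ x ∈ T, Real.exp (∑ l ∈ Λ, u l x * (1 / 2)) := by
    set b : ℝ := Λ.card / 4 with hb
    have h1 : ∀ x ∈ T, Real.exp b * (1 + (∑ l ∈ Λ, u l x * (1 / 2) - b)) ≤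
        Real.exp (∑ l ∈ Λ, u l x * (1 / 2)) := by
      intro x _
      have h2 := Real.add_one_le_exp (∑ l ∈ Λ, u l x * (1 / 2) - b)
      calc _ ≤ Real.exp b * Real.exp (∑ l ∈ Λ, u l x * (1 / 2) - b) := by
            gcongr; linarith
        _ = _ := by rw [← Real.exp_add]; congr 1; ring
    refine le_trans ?_ (Finset.sum_le_sum h1)
    rw [← Finset.mul_sum, mul_comm]
    refine mul_le_mul_of_nonneg_left ?_ (Real.exp_pos _).le
    rw [Finset.sum_add_distrib, Finset.sum_sub_distrib, Finset.sum_comm]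
    have h3 : (Λ.card : ℝ) * (T.card / 4) ≤ ∑ l ∈ Λ, ∑ x ∈ T, u l x * (1 / 2) := by
      rw [← nsmul_eq_mul, ← Finset.sum_const]
      refine Finset.sum_le_sum fun l hl => ?_
      rw [← Finset.sum_mul]
      linarith [hmean l hl]
    simp only [Finset.sum_const, nsmul_eq_mul, mul_one]
    rw [hb]; linarith
  have hcosh : Real.cosh (1 / 2) ^ Λ.card ≤ Real.exp (Λ.card / 8) := by
    calc _ ≤ Real.exp ((1 / 2) ^ 2 / 2) ^ Λ.card :=
          pow_le_pow_left₀ hch.le (Real.cosh_le_exp_half_sq _) _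
      _ = _ := by rw [← Real.exp_nat_mul]; congr 1; ring
  have hfin : (T.card : ℝ) * Real.exp (Λ.card / 4) ≤ Real.exp (Λ.card / 8) * (4 * (N 0).card) := by
    refine hlow.trans ((Finset.sum_le_sum fun x _ => hpt x).trans ?_)
    rw [← Finset.mul_sum]
    have h1 : ∑ x ∈ T, riesz c Λ x ≤ ∑ x ∈ N 0, riesz c Λ x :=
      Finset.sum_le_sum_of_subset_of_nonneg hTN fun x _ _ => riesz_nonneg c hc1 Λ x
    have h0 : 0 ≤ ∑ x ∈ T, riesz c Λ x := Finset.sum_nonneg fun x _ => riesz_nonneg c hc1 Λ x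
    exact mul_le_mul hcosh (by linarith) h0 (Real.exp_pos _).le
  have h9 : Real.exp (Λ.card / 4 : ℝ) = Real.exp (Λ.card / 8) * Real.exp (Λ.card / 8) := by
    rw [← Real.exp_add]; congr 1; ring
  have h10 : (T.card : ℝ) * Real.exp (Λ.card / 8) ≤ 4 * (N 0).card := by
    rw [h9] at hfin
    have := Real.exp_pos (Λ.card / 8 : ℝ)
    refine le_of_mul_le_mul_left ?_ this
    linarith
  have h11 : Real.exp (Λ.card / 8) ≤ 4 / τ := by
    rw [le_div_iff₀ hτ]
    have : (T.card : ℝ) * (Real.exp (Λ.card / 8) * τ) ≤ T.card * 4 := by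
      nlinarith
    exact le_of_mul_le_mul_left this hTc0
  have h12 := (Real.le_log_iff_exp_le (by positivity)).mpr h11
  linarith

lemma hat_reg {E : Finset G} {δ : ℝ} {t : G} (hE : E.Nonempty) (h : RegAt E δ t)
    (ψ : AddChar G ℂ) (hψ : 1 / 2 ≤ ‖hat E ψ‖) : ‖ψ t - 1‖ ≤ 4 * δ := by
  have hEc : (0 : ℝ) < E.card := by exact_mod_cast hE.card_pos
  set E' := E.image (fun e => e + t) with hE'
  have hinj : ∀ x ∈ E, ∀ y ∈ E, x + t = y + t → x = y := fun a _ b _ h => by simpa using h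
  have hcE' : E'.card = E.card := Finset.card_image_of_injOn hinj
  have h1 : ∑ y ∈ E', ψ y = ψ t * ∑ x ∈ E, ψ x := by
    rw [hE', Finset.sum_image hinj, Finset.mul_sum]
    refine Finset.sum_congr rfl fun x _ => ?_
    rw [AddChar.map_add_eq_mul, mul_comm]
  have h2 : ((E' \ E).card : ℝ) ≤ δ * E.card := by
    refine le_trans ?_ h
    have : E' \ E ⊆ (E.filter (fun y => y + t ∉ E)).image (fun e => e + t) := by
      intro y hy
      rw [Finset.mem_sdiff, hE', Finset.mem_image] at hy
      obtain ⟨⟨e, he, rfl⟩, h⟩ := hy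
      exact Finset.mem_image_of_mem _ (Finset.mem_filter.mpr ⟨he, h⟩)
    exact_mod_cast (Finset.card_le_card this).trans Finset.card_image_le
  have h3 : (E \ E').card = (E' \ E).card := (Finset.card_sdiff_comm hcE').symm
  have h4 : ∑ y ∈ E', ψ y - ∑ x ∈ E, ψ x = ∑ y ∈ E' \ E, ψ y - ∑ y ∈ E \ E', ψ y := by
    rw [← Finset.sum_sdiff_sub_sum_sdiff]
  have h5 : ‖∑ y ∈ E', ψ y - ∑ x ∈ E, ψ x‖ ≤ 2 * (δ * E.card) := by
    rw [h4]
    refine (norm_sub_le _ _).trans ?_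
    have b : ∀ S : Finset G, ‖∑ y ∈ S, ψ y‖ ≤ S.card := fun S => by
      refine (norm_sum_le _ _).trans ?_
      simp [AddChar.norm_apply]
    have b1 := b (E' \ E)
    have b2 := b (E \ E')
    rw [h3] at b2
    linarith
  have h6 : ∑ x ∈ E, ψ x = E.card * hat E ψ := by
    have : (E.card : ℂ) ≠ 0 := by exact_mod_cast hEc.ne'
    unfold hat; field_simp
  have h7 : ∑ y ∈ E', ψ y - ∑ x ∈ E, ψ x = (ψ t - 1) * (E.card * hat E ψ) := by
    rw [h1, h6]; ring
  rw [h7, norm_mul, norm_mul, Complex.norm_natCast] at h5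
  have h8 : ‖ψ t - 1‖ * (E.card * (1 / 2)) ≤ ‖ψ t - 1‖ * (E.card * ‖hat E ψ‖) := by gcongr
  have h9 : E.card * ‖ψ t - 1‖ ≤ E.card * (4 * δ) := by linarith
  exact le_of_mul_le_mul_left h9 hEc

lemma char_sum_sub_one (Λ : Finset (AddChar G ℂ)) (ε : AddChar G ℂ → ℤ) (hε : Sgn ε) (t : G) (ε1 : ℝ)
    (h : ∀ l ∈ Λ, ‖l t - 1‖ ≤ ε1) : ‖(∑ l ∈ Λ, ε l • l) t - 1‖ ≤ Λ.card * ε1 := by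
  classical
  induction Λ using Finset.induction_on with
  | empty => simp
  | insert l Λ hl ih =>
    have h1 := ih fun i hi => h i (Finset.mem_insert_of_mem hi)
    have hl1 := h l (Finset.mem_insert_self _ _)
    have h2 : ‖(ε l • l) t - 1‖ ≤ ε1 := by
      rcases hε l with e | e | e
      · rw [e, neg_one_zsmul, AddChar.neg_apply, AddChar.map_neg_eq_conj]
        have : (starRingEnd ℂ) (l t) - 1 = (starRingEnd ℂ) (l t - 1) := by simp
        rw [this, RCLike.norm_conj]; exact hl1
      · rw [e, zero_zsmul]; simpa using (norm_nonneg _).trans hl1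
      · rw [e, one_zsmul]; exact hl1
    rw [Finset.sum_insert hl, AddChar.add_apply, Finset.card_insert_of_notMem hl]
    have e : (ε l • l) t * (∑ l ∈ Λ, ε l • l) t - 1 =
      (ε l • l) t * ((∑ l ∈ Λ, ε l • l) t - 1) + ((ε l • l) t - 1) := by ring
    rw [e]
    refine (norm_add_le _ _).trans ?_
    rw [norm_mul, AddChar.norm_apply, one_mul]
    rw [Nat.cast_succ]; linarith

lemma chang {E T : Finset G} (hE : E.Nonempty) (N : ℕ → Finset G)
    (hN : ∀ j, ∀ d ∈ N j, ∀ e ∈ E, d - e ∈ N (j + 1)) (M : ℕ)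
    (hTN : T ⊆ N 0) (hT : T.Nonempty) (τ : ℝ) (hτ : 0 < τ) (hTc : τ * (N 0).card ≤ T.card)
    (hM2 : ((N M).card : ℝ) ≤ 2 * (N 0).card) (hNM : (N M).Nonempty)
    (hM : 8 * Real.log (4 / τ) < M) :
    ∃ Λ : Finset (AddChar G ℂ), Λ.card ≤ M ∧ ∀ (t : G) (δ ε1 : ℝ), 0 ≤ δ → 0 ≤ ε1 → RegAt E δ t →
      (∀ l ∈ Λ, ‖l t - 1‖ ≤ ε1) → ∀ γ, 1 / 2 ≤ ‖hat T γ‖ → ‖γ t - 1‖ ≤ 4 * δ + M * ε1 := by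
  classical
  set fam : Finset (Finset (AddChar G ℂ)) := univ.filter fun Λ =>
    Diss E Λ ∧ Λ.card ≤ M ∧ ∀ l ∈ Λ, 1 / 2 ≤ ‖hat T l‖ with hfam
  have hne : fam.Nonempty := ⟨∅, by
    rw [hfam, Finset.mem_filter]
    refine ⟨mem_univ _, ?_, by simp, by simp⟩
    rintro ε _ ⟨l, hl, _⟩
    simp at hl⟩
  obtain ⟨Λ, hΛ, hmax⟩ := Finset.exists_max_image fam Finset.card hne
  rw [hfam, Finset.mem_filter] at hΛ
  obtain ⟨-, hD, hc, hsp⟩ := hΛ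
  refine ⟨Λ, hc, fun t δ ε1 hδ hε1 hreg hΛt γ hγ => ?_⟩
  have hlt : Λ.card < M := by
    have := chang_card hE N hN M hTN hT τ hτ hTc hM2 hNM Λ hD hc hsp
    exact_mod_cast this.trans_lt hM
  have hcM : (Λ.card : ℝ) + 1 ≤ M := by exact_mod_cast hlt
  by_cases hγΛ : γ ∈ Λ
  · have h1 := hΛt γ hγΛ
    have : (1 : ℝ) ≤ M := by
      have : (0 : ℝ) ≤ Λ.card := Nat.cast_nonneg _
      linarith
    nlinarith
  have hnd : ¬ Diss E (insert γ Λ) := by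
    intro hd
    have hm : insert γ Λ ∈ fam := by
      rw [hfam, Finset.mem_filter]
      refine ⟨mem_univ _, hd, by rw [Finset.card_insert_of_notMem hγΛ]; omega, ?_⟩
      intro l hl
      rcases Finset.mem_insert.mp hl with rfl | hl
      · exact hγ
      · exact hsp l hl
    have := hmax _ hm
    rw [Finset.card_insert_of_notMem hγΛ] at this
    omega
  unfold Diss at hnd
  push Not at hnd
  obtain ⟨ε, hε, hne, hbig⟩ := hnd
  rw [Finset.sum_insert hγΛ] at hbig
  have hεγ : ε γ ≠ 0 := by
    intro h0
    rw [h0, zero_zsmul, zero_add] at hbig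
    obtain ⟨l, hl, hl0⟩ := hne
    rcases Finset.mem_insert.mp hl with rfl | hl
    · exact hl0 h0
    · exact absurd (hD ε hε ⟨l, hl, hl0⟩) (not_le.mpr hbig)
  have h1 := hat_reg hE hreg _ hbig.le
  have h2 := char_sum_sub_one Λ ε hε t ε1 hΛt
  set S := (∑ l ∈ Λ, ε l • l) with hS
  have h3 : ‖(ε γ • γ) t - 1‖ ≤ 4 * δ + Λ.card * ε1 := by
    rw [AddChar.add_apply] at h1
    have e : ‖(ε γ • γ) t - 1‖ = ‖((ε γ • γ) t - 1) * S t‖ := by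
      rw [norm_mul, AddChar.norm_apply, mul_one]
    have e2 : ((ε γ • γ) t - 1) * S t = ((ε γ • γ) t * S t - 1) - (S t - 1) := by ring
    rw [e, e2]
    exact (norm_sub_le _ _).trans (by linarith)
  have h4 : ‖γ t - 1‖ = ‖(ε γ • γ) t - 1‖ := by
    rcases hε γ with e | e | e
    · rw [e, neg_one_zsmul, AddChar.neg_apply, AddChar.map_neg_eq_conj]
      have : (starRingEnd ℂ) (γ t) - 1 = (starRingEnd ℂ) (γ t - 1) := by simp
      rw [this, RCLike.norm_conj]
    · exact absurd e hεγ
    · rw [e, one_zsmul]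
  rw [h4]
  nlinarith
end KM

namespace KM
open Finset
set_option linter.unusedSectionVars false
variable {G : Type*} [AddCommGroup G] [Fintype G] [DecidableEq G]

open Classical in
/-- Bohr sets -/
noncomputable def Bohr (Γ : Finset (AddChar G ℂ)) (r : ℝ) : Finset G :=
  univ.filter fun x => ∀ γ ∈ Γ, ‖γ x - 1‖ ≤ r

lemma mem_bohr {Γ : Finset (AddChar G ℂ)} {r : ℝ} {x : G} :
    x ∈ Bohr Γ r ↔ ∀ γ ∈ Γ, ‖γ x - 1‖ ≤ r := by
  simp [Bohr]

lemma bohr_zero {Γ : Finset (AddChar G ℂ)} {r : ℝ} (hr : 0 ≤ r) : (0 : G) ∈ Bohr Γ r := by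
  rw [mem_bohr]; intro γ _; simpa using hr

lemma bohr_neg {Γ : Finset (AddChar G ℂ)} {r : ℝ} {x : G} (hx : x ∈ Bohr Γ r) : -x ∈ Bohr Γ r := by
  rw [mem_bohr] at *
  intro γ hγ
  rw [AddChar.map_neg_eq_conj]
  have : (starRingEnd ℂ) (γ x) - 1 = (starRingEnd ℂ) (γ x - 1) := by simp
  rw [this, RCLike.norm_conj]; exact hx γ hγ

lemma bohr_add {Γ : Finset (AddChar G ℂ)} {r s : ℝ} {x y : G} (hx : x ∈ Bohr Γ r)
    (hy : y ∈ Bohr Γ s) : x + y ∈ Bohr Γ (r + s) := by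
  rw [mem_bohr] at *
  intro γ hγ
  rw [AddChar.map_add_eq_mul]
  have e : γ x * γ y - 1 = γ x * (γ y - 1) + (γ x - 1) := by ring
  rw [e]
  refine (norm_add_le _ _).trans ?_
  rw [norm_mul, AddChar.norm_apply, one_mul]
  linarith [hx γ hγ, hy γ hγ]

lemma bohr_mono {Γ : Finset (AddChar G ℂ)} {r s : ℝ} (h : r ≤ s) : Bohr Γ r ⊆ Bohr Γ s := by
  intro x hx
  rw [mem_bohr] at *
  exact fun γ hγ => (hx γ hγ).trans h

lemma bohr_sub {Γ : Finset (AddChar G ℂ)} {r s : ℝ} {x y : G} (hx : x ∈ Bohr Γ r)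
    (hy : y ∈ Bohr Γ s) : x - y ∈ Bohr Γ (r + s) := by
  rw [sub_eq_add_neg]; exact bohr_add hx (bohr_neg hy)

lemma bohr_nonempty {Γ : Finset (AddChar G ℂ)} {r : ℝ} (hr : 0 ≤ r) : (Bohr Γ r).Nonempty :=
  ⟨0, bohr_zero hr⟩

lemma floor_close {a b K : ℝ} (hK : 0 < K) (h : ⌊K * a⌋ = ⌊K * b⌋) : |a - b| ≤ 1 / K := by
  have h1 := Int.abs_sub_lt_one_of_floor_eq_floor h
  rw [← mul_sub, abs_mul, abs_of_pos hK] at h1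
  rw [le_div_iff₀ hK]; linarith

lemma bohr_size (Γ : Finset (AddChar G ℂ)) (i : ℕ) {r : ℝ} (hr : (1 / 2) ^ i ≤ r) :
    (Fintype.card G : ℝ) ≤ 2 ^ (2 * (i + 3) * Γ.card) * (Bohr Γ r).card := by
  classical
  set K : ℕ := 2 ^ (i + 1) with hK
  have hKpos : (0 : ℝ) < K := by rw [hK]; positivity
  set cell : Finset (ℤ × ℤ) := Finset.Icc (-(K : ℤ)) K ×ˢ Finset.Icc (-(K : ℤ)) K with hcell
  set S : Finset (∀ γ ∈ Γ, ℤ × ℤ) := Γ.pi fun _ => cell with hS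
  set f : G → (∀ γ ∈ Γ, ℤ × ℤ) := fun x γ _ => (⌊(K : ℝ) * (γ x).re⌋, ⌊(K : ℝ) * (γ x).im⌋) with hf
  have hfl : ∀ a : ℝ, |a| ≤ 1 → ⌊(K : ℝ) * a⌋ ∈ Finset.Icc (-(K : ℤ)) K := by
    intro a ha
    rw [abs_le] at ha
    rw [Finset.mem_Icc]
    constructor
    · rw [Int.le_floor]; push_cast; nlinarith
    · have : ⌊(K : ℝ) * a⌋ ≤ ⌊(K : ℝ)⌋ := Int.floor_le_floor (by nlinarith)
      rwa [Int.floor_natCast] at this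
  have hmaps : ∀ x ∈ (univ : Finset G), f x ∈ S := by
    intro x _
    rw [hS, Finset.mem_pi]
    intro γ hγ
    rw [hcell, Finset.mem_product]
    have hn : ‖γ x‖ = 1 := AddChar.norm_apply γ x
    exact ⟨hfl _ ((Complex.abs_re_le_norm _).trans hn.le), hfl _ ((Complex.abs_im_le_norm _).trans hn.le)⟩
  have hfib : ∀ b ∈ S, (univ.filter fun x => f x = b).card ≤ (Bohr Γ r).card := by
    intro b _
    rcases (univ.filter fun x => f x = b).eq_empty_or_nonempty with h | ⟨x0, hx0⟩
    · rw [h]; simp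
    · refine Finset.card_le_card_of_injOn (fun x => x - x0) ?_ (fun a _ b _ h => by simpa using h)
      intro x hx
      have hx1 : f x = b := by simpa using hx
      have hx2 : f x0 = b := by simpa using hx0
      rw [Finset.mem_coe, mem_bohr]
      intro γ hγ
      have h1 : f x γ hγ = f x0 γ hγ := by rw [hx1, hx2]
      rw [hf] at h1
      simp only [Prod.mk.injEq] at h1
      have e : γ (x - x0) - 1 = (γ x - γ x0) * γ (-x0) := by
        rw [sub_eq_add_neg x x0, AddChar.map_add_eq_mul, sub_mul, ← AddChar.map_add_eq_mul γ x0]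
        simp
      simp only
      rw [e, norm_mul, AddChar.norm_apply, mul_one]
      refine (Complex.norm_le_abs_re_add_abs_im _).trans ?_
      rw [Complex.sub_re, Complex.sub_im]
      have c1 := floor_close hKpos h1.1
      have c2 := floor_close hKpos h1.2
      have : 1 / (K : ℝ) + 1 / K = (1 / 2) ^ i := by
        rw [hK]; push_cast; rw [pow_succ, one_div_pow]; field_simp; norm_num
      linarith
  have h1 := Finset.card_le_mul_card_image_of_maps_to hmaps _ hfib
  have hcS : S.card ≤ 2 ^ (2 * (i + 3) * Γ.card) := by
    rw [hS, Finset.card_pi, Finset.prod_const, hcell, Finset.card_product, Int.card_Icc]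
    rw [pow_mul]
    refine Nat.pow_le_pow_left ?_ _
    have : ((K : ℤ) + 1 - -(K : ℤ)).toNat = 2 * K + 1 := by omega
    rw [this]
    have h2 : 2 * K + 1 ≤ 2 ^ (i + 3) := by
      have : 1 ≤ K := Nat.one_le_two_pow
      rw [hK] at *
      rw [pow_succ 2 (i+2), pow_succ 2 (i+1)]; omega
    calc _ ≤ 2 ^ (i + 3) * 2 ^ (i + 3) := Nat.mul_le_mul h2 h2
      _ = _ := by rw [← pow_add]; congr 1; ring
  rw [Finset.card_univ] at h1
  have h3 : Fintype.card G ≤ 2 ^ (2 * (i + 3) * Γ.card) * (Bohr Γ r).card := by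
    refine h1.trans ?_
    rw [mul_comm]
    exact Nat.mul_le_mul_right _ hcS
  exact_mod_cast h3

lemma bohr_reg (Γ : Finset (AddChar G ℂ)) (d i s κ : ℕ) (hd : Γ.card ≤ d)
    (hJ : 2 ^ s * (2 * (i + 4) * d) ≤ 2 ^ κ) :
    ∃ ρ : ℝ, (1 / 2) ^ (i + 1) ≤ ρ ∧ ρ ≤ (1 / 2) ^ i ∧
      ((Bohr Γ (ρ + (1 / 2) ^ (i + 1 + κ))).card : ℝ) ≤ (1 + (1 / 2) ^ s) * (Bohr Γ ρ).card := by
  by_contra hcon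
  push Not at hcon
  set σ : ℝ := (1 / 2) ^ (i + 1 + κ) with hσ
  have hσ0 : 0 < σ := by positivity
  have h2σ : (2 : ℝ) ^ κ * σ = (1 / 2) ^ (i + 1) := by
    rw [hσ, pow_add _ _ κ, mul_comm, mul_assoc, ← mul_pow]; norm_num
  have hhalf : (1 / 2 : ℝ) ^ i = (1 / 2) ^ (i + 1) + (1 / 2) ^ (i + 1) := by rw [pow_succ]; ring
  have key : ∀ j : ℕ, 0 < j → j ≤ 2 ^ κ → (1 + (1 / 2 : ℝ) ^ s) ^ j * (Bohr Γ ((1 / 2) ^ (i + 1))).card <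
      (Bohr Γ ((1 / 2) ^ (i + 1) + j * σ)).card := by
    intro j hj
    induction j with
    | zero => omega
    | succ j ih =>
      intro hj2
      have hj3 : ((j : ℝ) + 1) ≤ 2 ^ κ := by exact_mod_cast hj2
      have hc := hcon ((1 / 2) ^ (i + 1) + j * σ) (by nlinarith [Nat.cast_nonneg (α := ℝ) j]) (by
        rw [hhalf, ← h2σ]; nlinarith)
      have e : (1 / 2 : ℝ) ^ (i + 1) + j * σ + σ = (1 / 2) ^ (i + 1) + ((j + 1 : ℕ) : ℝ) * σ := by
        push_cast; ring
      rw [e] at hc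
      refine lt_of_le_of_lt ?_ hc
      rw [pow_succ, mul_right_comm, mul_comm]
      refine mul_le_mul_of_nonneg_left ?_ (by positivity)
      rcases Nat.eq_zero_or_pos j with rfl | hj0
      · simp
      · exact (ih hj0 (by omega)).le
  have h1 := key (2 ^ κ) (by positivity) le_rfl
  have h2 := bohr_size Γ (i + 1) (le_refl ((1 / 2 : ℝ) ^ (i + 1)))
  have h3 : ((Bohr Γ ((1 / 2) ^ (i + 1) + ((2 ^ κ : ℕ) : ℝ) * σ)).card : ℝ) ≤ Fintype.card G := by
    exact_mod_cast Finset.card_le_univ _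
  have h4 : (2 : ℝ) ^ (2 * (i + 1 + 3) * Γ.card) ≤ (1 + (1 / 2 : ℝ) ^ s) ^ (2 ^ κ) := by
    have b1 : (2 : ℝ) ≤ (1 + (1 / 2 : ℝ) ^ s) ^ (2 ^ s) := by
      have := one_add_mul_le_pow (a := (1 / 2 : ℝ) ^ s) (by
        have : (0 : ℝ) ≤ (1 / 2) ^ s := by positivity
        linarith) (2 ^ s)
      refine le_trans (le_of_eq ?_) this
      push_cast
      rw [← mul_pow]; norm_num
    calc (2 : ℝ) ^ (2 * (i + 1 + 3) * Γ.card) ≤ 2 ^ (2 * (i + 4) * d) :=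
          pow_le_pow_right₀ (by norm_num) (Nat.mul_le_mul_left _ hd)
      _ ≤ ((1 + (1 / 2 : ℝ) ^ s) ^ (2 ^ s)) ^ (2 * (i + 4) * d) :=
          pow_le_pow_left₀ (by norm_num) b1 _
      _ = (1 + (1 / 2 : ℝ) ^ s) ^ (2 ^ s * (2 * (i + 4) * d)) := by rw [← pow_mul]
      _ ≤ _ := pow_le_pow_right₀ (by
        have : (0 : ℝ) ≤ (1 / 2) ^ s := by positivity
        linarith) hJ
  have h5 := mul_le_mul_of_nonneg_right h4 (Nat.cast_nonneg (α := ℝ) (Bohr Γ ((1 / 2) ^ (i + 1))).card)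
  linarith

lemma reg_of {P W : Finset G} {δ : ℝ} {x : G} (hPW : P ⊆ W) (h : ∀ y ∈ P, y + x ∈ W)
    (hc : (W.card : ℝ) ≤ (1 + δ) * P.card) : RegAt P δ x := by
  unfold RegAt
  have h1 : (P.filter (fun y => y + x ∉ P)).card ≤ (W \ P).card := by
    refine Finset.card_le_card_of_injOn (fun y => y + x) ?_ (fun a _ b _ h => by simpa using h)
    intro y hy
    rw [Finset.mem_coe, Finset.mem_filter] at hy
    rw [Finset.mem_coe, Finset.mem_sdiff]
    exact ⟨h y hy.1, hy.2⟩
  have h2 := Finset.card_sdiff_add_card_eq_card hPW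
  have h1' : ((P.filter (fun y => y + x ∉ P)).card : ℝ) ≤ (W \ P).card := by exact_mod_cast h1
  have h2' : ((W \ P).card : ℝ) + P.card = W.card := by exact_mod_cast h2
  linarith

lemma bohr_regAt {Γ : Finset (AddChar G ℂ)} {ρ σ δ : ℝ} {x : G} (hσ : 0 ≤ σ)
    (hc : ((Bohr Γ (ρ + σ)).card : ℝ) ≤ (1 + δ) * (Bohr Γ ρ).card) (hx : x ∈ Bohr Γ σ) :
    RegAt (Bohr Γ ρ) δ x :=
  reg_of (bohr_mono (by linarith)) (fun _ hy => bohr_add hy hx) hc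

/-- transport of frequencies by an automorphism -/
noncomputable def tw [DecidableEq (AddChar G ℂ)] (e : G ≃+ G) (Γ : Finset (AddChar G ℂ)) :
    Finset (AddChar G ℂ) :=
  Γ.image fun γ => γ.compAddMonoidHom e.symm.toAddMonoidHom

lemma mem_bohr_tw [DecidableEq (AddChar G ℂ)] (e : G ≃+ G) (Γ : Finset (AddChar G ℂ)) (r : ℝ) (y : G) :
    y ∈ Bohr (tw e Γ) r ↔ e.symm y ∈ Bohr Γ r := by
  rw [mem_bohr, mem_bohr, tw]
  simp

lemma bohr_tw [DecidableEq (AddChar G ℂ)] (e : G ≃+ G) (Γ : Finset (AddChar G ℂ)) (r : ℝ) :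
    Bohr (tw e Γ) r = (Bohr Γ r).image e := by
  ext y
  rw [mem_bohr_tw, Finset.mem_image]
  constructor
  · intro h; exact ⟨_, h, by simp⟩
  · rintro ⟨x, hx, rfl⟩; simpa using hx

lemma bohr_tw_card [DecidableEq (AddChar G ℂ)] (e : G ≃+ G) (Γ : Finset (AddChar G ℂ)) (r : ℝ) :
    (Bohr (tw e Γ) r).card = (Bohr Γ r).card := by
  rw [bohr_tw, Finset.card_image_of_injective _ e.injective]

lemma tw_card [DecidableEq (AddChar G ℂ)] (e : G ≃+ G) (Γ : Finset (AddChar G ℂ)) :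
    (tw e Γ).card ≤ Γ.card := Finset.card_image_le
end KM

namespace KM
open Finset
set_option linter.unusedSectionVars false
variable {G : Type*} [AddCommGroup G] [Fintype G] [DecidableEq G]

lemma avT_iter_smul (T : Finset G) (a : ℝ) (F : G → ℝ) (k : ℕ) (x : G) :
    (avT T)^[k] (fun y => a * F y) x = a * (avT T)^[k] F x := by
  induction k generalizing x with
  | zero => rfl
  | succ k ih =>
    rw [Function.iterate_succ_apply', Function.iterate_succ_apply']
    simp only [avT, ih, ← Finset.mul_sum, mul_div_assoc]

lemma avX_smul (X : Finset G) (a : ℝ) (F : G → ℝ) (x : G) :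
    avX X (fun y => a * F y) x = a * avX X F x := by
  simp only [avX, ← Finset.mul_sum, mul_div_assoc]

lemma avX_mono (X : Finset G) {F F' : G → ℝ} (h : ∀ x, F x ≤ F' x) (x : G) :
    avX X F x ≤ avX X F' x := by
  unfold avX; gcongr; exact h _

/-- number of samples -/
def nn (ℓ : ℕ) : ℕ := 8 * 10 ^ 11 * ℓ ^ 4
/-- rank increment -/
def MM (ℓ : ℕ) : ℕ := 10 ^ 16 * ℓ ^ 6

lemma theta_bound (ℓ : ℕ) (hℓ : 1 ≤ ℓ) :
    4 * Real.exp (-((nn ℓ : ℝ) * (1 / (20000 * ℓ)) ^ 2 / 2)) ≤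
      (1 / 2) ^ (1300 * ℓ ^ 2) / (50000 * ℓ) := by
  have hl : (1 : ℝ) ≤ ℓ := by exact_mod_cast hℓ
  have e1 : (nn ℓ : ℝ) * (1 / (20000 * ℓ)) ^ 2 / 2 = 1000 * ℓ ^ 2 := by
    unfold nn; push_cast; field_simp; norm_num
  rw [e1, le_div_iff₀ (by positivity)]
  have e2 : ((1 : ℝ) / 2) ^ (1300 * ℓ ^ 2) = Real.exp (-(1300 * ℓ ^ 2 * Real.log 2)) := by
    rw [← Real.exp_log (show (0 : ℝ) < 1 / 2 by norm_num), ← Real.exp_nat_mul]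
    congr 1
    rw [one_div, Real.log_inv]; push_cast; ring
  rw [e2]
  have h2 := Real.log_two_lt_d9
  have h3 : (200000 * ℓ : ℝ) ≤ Real.exp (14 * ℓ ^ 2) := by
    have a1 : (ℓ : ℝ) ≤ Real.exp (ℓ ^ 2) := by
      have := Real.add_one_le_exp ((ℓ : ℝ) ^ 2); nlinarith
    have a2 : (200000 : ℝ) ≤ Real.exp (13 * ℓ ^ 2) := by
      have b1 : (2.7 : ℝ) ≤ Real.exp 1 := by linarith [Real.exp_one_gt_d9]
      calc (200000 : ℝ) ≤ 2.7 ^ 13 := by norm_num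
        _ ≤ Real.exp 1 ^ 13 := pow_le_pow_left₀ (by norm_num) b1 _
        _ = Real.exp 13 := by rw [← Real.exp_nat_mul]; norm_num
        _ ≤ _ := by apply Real.exp_le_exp.mpr; nlinarith
    calc (200000 * ℓ : ℝ) ≤ Real.exp (13 * ℓ ^ 2) * Real.exp (ℓ ^ 2) := by gcongr
      _ = _ := by rw [← Real.exp_add]; congr 1; ring
  calc 4 * Real.exp (-(1000 * ℓ ^ 2)) * (50000 * ℓ) = (200000 * ℓ) * Real.exp (-(1000 * ℓ ^ 2)) := by ring
    _ ≤ Real.exp (14 * ℓ ^ 2) * Real.exp (-(1000 * ℓ ^ 2)) := by gcongr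
    _ = Real.exp (-(986 * ℓ ^ 2)) := by rw [← Real.exp_add]; congr 1; ring
    _ ≤ _ := by apply Real.exp_le_exp.mpr; nlinarith

lemma M_bound (ℓ : ℕ) (hℓ : 1 ≤ ℓ) :
    8 * Real.log (4 / (((1 / 2) ^ (1300 * ℓ ^ 2) / 2) ^ (nn ℓ) / 2)) < MM ℓ := by
  have hl : (1 : ℝ) ≤ ℓ := by exact_mod_cast hℓ
  have e : (4 : ℝ) / (((1 / 2) ^ (1300 * ℓ ^ 2) / 2) ^ (nn ℓ) / 2) =
      2 ^ ((1300 * ℓ ^ 2 + 1) * nn ℓ + 3) := by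
    have : ((1 : ℝ) / 2) ^ (1300 * ℓ ^ 2) / 2 = (2 ^ (1300 * ℓ ^ 2 + 1))⁻¹ := by
      rw [pow_succ (2 : ℝ) (1300 * ℓ ^ 2), one_div, inv_pow, mul_inv, div_eq_mul_inv]
    rw [this, inv_pow, ← pow_mul, pow_add _ _ 3]
    field_simp; norm_num
  rw [e, Real.log_pow]
  have h2 := Real.log_two_lt_d9
  have h2' := Real.log_pos (x := 2) (by norm_num)
  have h3 : (((1300 * ℓ ^ 2 + 1) * nn ℓ + 3 : ℕ) : ℝ) ≤ 1.05e15 * ℓ ^ 6 := by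
    unfold nn; push_cast
    have p4 : (ℓ : ℝ) ^ 4 ≤ ℓ ^ 6 := pow_le_pow_right₀ hl (by norm_num)
    have p0 : (1 : ℝ) ≤ ℓ ^ 6 := one_le_pow₀ hl
    have : (1300 * (ℓ : ℝ) ^ 2 + 1) * (800000000000 * ℓ ^ 4) + 3 =
      1300 * 800000000000 * ℓ ^ 6 + 800000000000 * ℓ ^ 4 + 3 := by ring
    rw [this]; norm_num; linarith
  have p0 : (0 : ℝ) < ℓ ^ 6 := by positivity
  calc 8 * ((((1300 * ℓ ^ 2 + 1) * nn ℓ + 3 : ℕ) : ℝ) * Real.log 2)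
      ≤ 8 * ((1.05e15 * ℓ ^ 6) * 1) := by gcongr; linarith
    _ < MM ℓ := by unfold MM; push_cast; norm_num; linarith

set_option maxHeartbeats 1000000 in
lemma increment (ℓ : ℕ) (hℓ : 1 ≤ ℓ) (Γ : Finset (AddChar G ℂ)) {A X : Finset G} (hA : A.Nonempty)
    {α p : ℝ} (hα : (1 / 2) ^ (ℓ + 1) ≤ α) (hp : (A.card : ℝ) = α * p)
    {ρ2 σ2 ρ3 σ3 ρ4 σ4 : ℝ} (h20 : 0 ≤ ρ2) (h30 : 0 ≤ ρ3) (h40 : 0 ≤ ρ4) (s40 : 0 ≤ σ4)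
    (hW2 : ((Bohr Γ (ρ2 + σ2)).card : ℝ) ≤ 2 * (Bohr Γ ρ2).card)
    (h32 : (20 * ℓ) * ρ3 ≤ σ2)
    (hW3 : ((Bohr Γ (ρ3 + σ3)).card : ℝ) ≤ 2 * (Bohr Γ ρ3).card)
    (h43 : MM ℓ * ρ4 ≤ σ3)
    (hW4 : ((Bohr Γ (ρ4 + σ4)).card : ℝ) ≤ (1 + (1 / 2) ^ 15) * (Bohr Γ ρ4).card)
    (hXD : X ⊆ Bohr Γ ρ2)
    (hX : (1 / 2) ^ (1300 * ℓ ^ 2) * ((Bohr Γ ρ2).card : ℝ) ≤ X.card)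
    (S : G → Prop) [DecidablePred S] (hS : ∀ x, S x ↔ 1.025 * (α ^ 2 * p) ≤ corr (ind A) x)
    (hbad : badPairs S X ≤ 0.002 * (X.card : ℝ) ^ 2) :
    ∃ Λ : Finset (AddChar G ℂ), Λ.card ≤ MM ℓ ∧ ∀ B : Finset G, B ⊆ Bohr Γ σ4 →
      (∀ b ∈ B, ∀ l ∈ Λ, ‖l b - 1‖ ≤ 0.001 / MM ℓ) →
      ∃ z, 1.016 * α * B.card ≤ ((B.filter fun b => b + z ∈ A).card : ℝ) := by
  have hl : (1 : ℝ) ≤ ℓ := by exact_mod_cast hℓ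
  have hMpos : (0 : ℝ) < MM ℓ := by unfold MM; push_cast; positivity
  set ξ : ℝ := (1 / 2) ^ (1300 * ℓ ^ 2) with hξ
  have hξ0 : 0 < ξ := by positivity
  have hDc : (0 : ℝ) < (Bohr Γ ρ2).card := by exact_mod_cast (bohr_nonempty h20).card_pos
  have hXc : (0 : ℝ) < X.card := lt_of_lt_of_le (by positivity) hX
  have hXne : X.Nonempty := Finset.card_pos.mp (by exact_mod_cast hXc)
  have hα0 : 0 < α := lt_of_lt_of_le (by positivity) hα
  have hAc : (0 : ℝ) < A.card := by exact_mod_cast hA.card_pos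
  have hp0 : 0 < p := by
    by_contra h
    push Not at h
    nlinarith
  set φ : G → ℝ := fun x => if S x then 1 else 0 with hφ
  have hφ0 : ∀ x, 0 ≤ φ x := fun x => by simp only [hφ]; split_ifs <;> norm_num
  have hφ1 : ∀ x, φ x ≤ 1 := fun x => by simp only [hφ]; split_ifs <;> norm_num
  have hρ3σ2 : ρ3 ≤ σ2 := by nlinarith
  obtain ⟨T, hTD, hTc, hTp⟩ := almost_periods (W := Bohr Γ (ρ2 + σ2)) hXD hXne
    (bohr_nonempty (Γ := Γ) h30) φ hφ0 hφ1 ξ hξ0 hX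
    (fun u hu t ht => bohr_mono (by linarith) (bohr_add hu ht)) hW2 (nn ℓ) (1 / (20000 * ℓ))
    (ξ / (50000 * ℓ)) (by positivity) (theta_bound ℓ hℓ) (by unfold nn; positivity)
  set τ : ℝ := (ξ / 2) ^ (nn ℓ) / 2 with hτ
  have hτ0 : 0 < τ := by positivity
  have hD'c : (0 : ℝ) < (Bohr Γ ρ3).card := by exact_mod_cast (bohr_nonempty h30).card_pos
  have hTpos : (0 : ℝ) < T.card := lt_of_lt_of_le (by positivity) hTc
  have hTne : T.Nonempty := Finset.card_pos.mp (by exact_mod_cast hTpos)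
  -- Chang
  obtain ⟨Λ, hΛc, hΛ⟩ := chang (E := Bohr Γ ρ4) (T := T) (bohr_nonempty h40)
    (fun j => Bohr Γ (ρ3 + j * ρ4))
    (fun j d hd e he => bohr_mono (by push_cast; linarith) (bohr_sub hd he)) (MM ℓ)
    (by simpa using hTD) hTne τ hτ0 (by simpa using hTc)
    (by
      simp only [Nat.cast_zero, zero_mul, add_zero]
      refine le_trans ?_ hW3
      exact_mod_cast Finset.card_le_card (bohr_mono (by linarith)))
    (bohr_nonempty (by positivity)) (M_bound ℓ hℓ)
  refine ⟨Λ, hΛc, fun B hB hBΛ => ?_⟩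
  -- lower bound
  set η : ℝ := 2 * (1 / (20000 * ℓ)) + 4 * (ξ / (50000 * ℓ)) / ξ with hη
  have hηv : η = 0.00018 / ℓ := by rw [hη]; field_simp; norm_num
  set k := 10 * ℓ with hk
  have hkr : (k : ℝ) = 10 * ℓ := by rw [hk]; push_cast; ring
  have hiter := iter_almost hTne (X := X) (avX X φ) η
    (fun j s => s ∈ Bohr Γ ((2 * (k : ℝ) - 2 * j) * ρ3))
    (fun j s hs t ht t' ht' => bohr_mono (by push_cast; linarith)
      (bohr_sub (bohr_add hs (hTD ht)) (hTD ht')))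
    (fun j s hs t ht t' ht' => by
      have hj : (0 : ℝ) ≤ j * ρ3 := by positivity
      refine hTp t ht t' ht' s (fun u hu => bohr_mono ?_ (bohr_add hu hs)) (fun u hu => ?_)
      · push_cast; rw [hkr]; linarith
      · have := bohr_add hu (bohr_sub (bohr_add hs (hTD ht)) (hTD ht'))
        rw [show u + s + t - t' = u + (s + t - t') by abel]
        refine bohr_mono ?_ this
        push_cast; rw [hkr]; linarith) k 0 (bohr_zero (by simp))
  simp only [add_zero] at hiter
  have hbase : ∑ u ∈ X, avX X φ u = ((X.card : ℝ) ^ 2 - badPairs S X) / X.card := by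
    unfold avX
    rw [← Finset.sum_div]
    congr 1
    have : ∀ u v, φ (u - v) = 1 - (if S (u - v) then 0 else 1 : ℝ) := by
      intro u v; simp only [hφ]; split_ifs <;> norm_num
    simp only [this, badPairs, Finset.sum_sub_distrib, Finset.sum_const, nsmul_eq_mul, mul_one]
    ring
  have hb2 : 0.998 * (X.card : ℝ) ≤ ∑ u ∈ X, avX X φ u := by
    rw [hbase, le_div_iff₀ hXc]; nlinarith
  have hkη : (k : ℝ) * η = 0.0018 := by rw [hkr, hηv]; field_simp; norm_num
  rw [hkη] at hiter
  have hlow : (1.025 * 0.996 * (α ^ 2 * p)) * X.card ≤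
      ∑ u ∈ X, (avT T)^[k] (avX X (corr (ind A))) u := by
    have hm : 0 < 1.025 * (α ^ 2 * p) := by positivity
    have h1 : ∀ x, 1.025 * (α ^ 2 * p) * φ x ≤ corr (ind A) x := by
      intro x
      simp only [hφ]
      split_ifs with h
      · rw [mul_one]; exact (hS x).mp h
      · rw [mul_zero]; exact corr_ind_nonneg A x
    have h2 : ∀ u, 1.025 * (α ^ 2 * p) * (avT T)^[k] (avX X φ) u ≤
        (avT T)^[k] (avX X (corr (ind A))) u := by
      intro u
      rw [← avT_iter_smul]
      refine avT_iter_mono T (fun x => ?_) k u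
      rw [← avX_smul]
      exact avX_mono X h1 x
    refine le_trans ?_ (Finset.sum_le_sum fun u _ => h2 u)
    rw [← Finset.mul_sum]
    have h3 : 0.996 * (X.card : ℝ) ≤ ∑ u ∈ X, (avT T)^[k] (avX X φ) u := by linarith
    calc _ = 1.025 * (α ^ 2 * p) * (0.996 * X.card) := by ring
      _ ≤ _ := mul_le_mul_of_nonneg_left h3 hm.le
  obtain ⟨z, hz⟩ := spec_increment (B := B) hA hXne hTne k _ hlow (fun γ hγ b hb => by
    have h1 := hΛ b ((1 / 2) ^ 15) (0.001 / MM ℓ) (by positivity) (by positivity)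
      (bohr_regAt s40 hW4 (hB hb)) (hBΛ b hb) γ hγ
    rw [mul_div_cancel₀ _ hMpos.ne'] at h1
    norm_num at h1 ⊢
    linarith)
  refine ⟨z, ?_⟩
  have h4 : 2 * (1 / 4 : ℝ) ^ k ≤ 0.0001 * α := by
    have e1 : (1 / 4 : ℝ) ^ k = (1 / 2) ^ (20 * ℓ) := by
      rw [hk, show (1 / 4 : ℝ) = (1 / 2) ^ 2 by norm_num, ← pow_mul]; congr 1; ring
    have e2 : (1 / 2 : ℝ) ^ (20 * ℓ) ≤ (1 / 2) ^ (ℓ + 1 + 17) :=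
      pow_le_pow_of_le_one (by norm_num) (by norm_num) (by omega)
    rw [e1]
    rw [pow_add] at e2
    have : (1 / 2 : ℝ) ^ 17 ≤ 0.00005 := by norm_num
    have h0 : (0 : ℝ) < (1 / 2) ^ (ℓ + 1) := by positivity
    nlinarith
  have h5 : A.card * (1.016 * α * B.card) ≤ A.card * ((B.filter fun b => b + z ∈ A).card : ℝ) := by
    refine le_trans ?_ hz
    have e : α ^ 2 * p = α * A.card := by rw [hp]; ring
    rw [e]
    have hBc : (0 : ℝ) ≤ B.card := Nat.cast_nonneg _
    have : 1.016 * α ≤ 0.996 * (1.025 * 0.996 * α) - 2 * (1 / 4) ^ k := by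
      nlinarith
    have h6 := mul_le_mul_of_nonneg_right this (mul_nonneg hAc.le hBc)
    calc _ = 1.016 * α * (A.card * B.card) := by ring
      _ ≤ _ := h6
      _ = _ := by ring
  exact le_of_mul_le_mul_left h5 hAc
end KM

namespace KM
open Finset
set_option linter.unusedSectionVars false
variable {G : Type*} [AddCommGroup G] [Fintype G] [DecidableEq G]

/-- number of three-term progressions -/
def T3 (A : Finset G) : ℝ := ∑ b, ind A b * cnv (ind A) (b + b)

/-- translate of a set -/
def tr (A : Finset G) (x : G) : Finset G := univ.filter fun y => y + x ∈ A

lemma ind_tr (A : Finset G) (x y : G) : ind (tr A x) y = ind A (y + x) := by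
  simp [ind, tr]

lemma T3_tr (A : Finset G) (x : G) : T3 (tr A x) = T3 A := by
  unfold T3
  rw [← Equiv.sum_comp (Equiv.addRight x) (fun b => ind A b * cnv (ind A) (b + b))]
  refine Finset.sum_congr rfl fun b _ => ?_
  simp only [Equiv.coe_addRight, ind_tr]
  congr 1
  unfold cnv
  rw [← Equiv.sum_comp (Equiv.addRight x) (fun y => ind A y * ind A (b + x + (b + x) - y))]
  refine Finset.sum_congr rfl fun y _ => ?_
  simp only [Equiv.coe_addRight, ind_tr]
  rw [show b + x + (b + x) - (y + x) = b + b - y + x by abel]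

/-- count of `A` on a translate of `B` -/
def cnt (A B : Finset G) (x : G) : ℝ := ∑ b ∈ B, ind A (b + x)

lemma cnt_nonneg (A B : Finset G) (x : G) : 0 ≤ cnt A B x :=
  Finset.sum_nonneg fun _ _ => ind_nonneg _ _

lemma cnt_eq (A B : Finset G) (x : G) : cnt A B x = ((B.filter fun b => b + x ∈ A).card : ℝ) := by
  unfold cnt ind; rw [Finset.sum_boole]

lemma cnt_le (A B : Finset G) (x : G) : cnt A B x ≤ B.card := by
  rw [cnt_eq]; exact_mod_cast Finset.card_filter_le _ _

lemma cnt_tr (A B : Finset G) (x y : G) : cnt (tr A x) B y = cnt A B (y + x) := by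
  unfold cnt
  refine Finset.sum_congr rfl fun b _ => ?_
  rw [ind_tr, add_assoc]

lemma shift_reg {A B : Finset G} {δ : ℝ} {t : G} (h : RegAt B δ (-t)) :
    ∑ x ∈ B, ind A x - δ * B.card ≤ ∑ x ∈ B, ind A (x + t) := by
  have h1 : ∑ x ∈ B, ind A x ≤ ∑ x ∈ B.filter (fun y => y + -t ∈ B), ind A x +
      ((B.filter (fun y => y + -t ∉ B)).card : ℝ) := by
    rw [← Finset.sum_filter_add_sum_filter_not B (fun y => y + -t ∈ B)]
    gcongr
    calc _ ≤ ∑ x ∈ B.filter (fun y => y + -t ∉ B), (1 : ℝ) := Finset.sum_le_sum fun x _ => ind_le_one A x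
      _ = _ := by simp
  have h2 : ∑ x ∈ B.filter (fun y => y + -t ∈ B), ind A x ≤ ∑ x ∈ B, ind A (x + t) := by
    have e : ∑ x ∈ B.filter (fun y => y + -t ∈ B), ind A x =
        ∑ x ∈ (B.filter (fun y => y + -t ∈ B)).image (fun y => y + -t), ind A (x + t) := by
      rw [Finset.sum_image (fun a _ b _ h => by simpa using h)]
      simp
    rw [e]
    refine Finset.sum_le_sum_of_subset_of_nonneg ?_ (fun _ _ _ => ind_nonneg _ _)
    intro y hy
    rw [Finset.mem_image] at hy
    obtain ⟨z, hz, rfl⟩ := hy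
    exact (Finset.mem_filter.mp hz).2
  unfold RegAt at h
  linarith

/-- finding a good common translate -/
lemma good_translate {A B P Q : Finset G} {δ α c : ℝ} (hPne : P.Nonempty) (hQne : Q.Nonempty)
    (hBne : B.Nonempty)
    (hB : α * B.card ≤ cnt A B 0)
    (hP : ∀ t ∈ P, RegAt B δ (-t)) (hQ : ∀ t ∈ Q, ∀ t' ∈ Q, RegAt B δ (-(t + t')))
    (hPu : ∀ x, cnt A P x ≤ (1 + c) * α * P.card) (hQu : ∀ x, cnt A Q x ≤ (1 + c) * α * Q.card)
    (hδ : 2 * δ ≤ c * α) :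
    ∃ x, (1 - 2 * c) * α * P.card ≤ cnt A P x ∧
      (1 - 2 * c) * α * (Q.card : ℝ) ^ 2 ≤ ∑ u ∈ Q, ∑ v ∈ Q, ind A (u + v + x) := by
  have hPc : (0 : ℝ) < P.card := by exact_mod_cast hPne.card_pos
  have hQc : (0 : ℝ) < Q.card := by exact_mod_cast hQne.card_pos
  have hBc : (0 : ℝ) < B.card := by exact_mod_cast hBne.card_pos
  have hB' : α * B.card ≤ ∑ x ∈ B, ind A x := by simpa [cnt] using hB
  have s1 : (α - δ) * B.card * P.card ≤ ∑ x ∈ B, cnt A P x := by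
    unfold cnt
    rw [Finset.sum_comm]
    calc _ = ∑ t ∈ P, (α - δ) * (B.card : ℝ) := by simp; ring
      _ ≤ _ := Finset.sum_le_sum fun t ht => by
        have := shift_reg (A := A) (hP t ht)
        simp_rw [add_comm t]
        linarith
  have s2 : (α - δ) * B.card * (Q.card : ℝ) ^ 2 ≤ ∑ x ∈ B, ∑ u ∈ Q, ∑ v ∈ Q, ind A (u + v + x) := by
    rw [Finset.sum_comm]
    calc _ = ∑ u ∈ Q, ∑ v ∈ Q, (α - δ) * (B.card : ℝ) := by simp; ring
      _ ≤ _ := Finset.sum_le_sum fun u hu => by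
        rw [Finset.sum_comm]
        refine Finset.sum_le_sum fun v hv => ?_
        have := shift_reg (A := A) (hQ u hu v hv)
        simp_rw [add_comm (u + v)]
        linarith
  have hgu : ∀ x, ∑ u ∈ Q, ∑ v ∈ Q, ind A (u + v + x) ≤ (1 + c) * α * (Q.card : ℝ) ^ 2 := by
    intro x
    calc _ = ∑ u ∈ Q, cnt A Q (u + x) := by
          unfold cnt
          refine Finset.sum_congr rfl fun u _ => Finset.sum_congr rfl fun v _ => ?_
          congr 1; abel
      _ ≤ ∑ u ∈ Q, (1 + c) * α * (Q.card : ℝ) := Finset.sum_le_sum fun u _ => hQu _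
      _ = _ := by simp; ring
  have hsum : ∑ x ∈ B, (2 * (α - δ)) ≤ ∑ x ∈ B, (cnt A P x / P.card +
      (∑ u ∈ Q, ∑ v ∈ Q, ind A (u + v + x)) / (Q.card : ℝ) ^ 2) := by
    rw [Finset.sum_add_distrib, ← Finset.sum_div, ← Finset.sum_div]
    have a1 := (le_div_iff₀ hPc).mpr s1
    have a2 := (le_div_iff₀ (by positivity : (0 : ℝ) < (Q.card : ℝ) ^ 2)).mpr s2
    simp only [Finset.sum_const, nsmul_eq_mul]
    linarith
  obtain ⟨x, -, hx⟩ := Finset.exists_le_of_sum_le hBne hsum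
  have f1 := (div_le_iff₀ hPc).mpr (hPu x)
  have g1 := (div_le_iff₀ (by positivity : (0 : ℝ) < (Q.card : ℝ) ^ 2)).mpr (hgu x)
  refine ⟨x, ?_, ?_⟩
  · rw [← le_div_iff₀ hPc]; linarith
  · rw [← le_div_iff₀ (by positivity : (0 : ℝ) < (Q.card : ℝ) ^ 2)]; linarith

lemma many_aps {A A1 Q : Finset G} (x : G) (hA1 : A1 ⊆ tr A x) :
    ∑ u ∈ Q, ∑ v ∈ Q, ind A (u + v + x) * cnv (ind A1) (u + v + (u + v)) ≤ Q.card * T3 A := by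
  have hmono : ∀ y, ind A1 y ≤ ind (tr A x) y := by
    intro y
    unfold ind
    by_cases h : y ∈ A1
    · simp [h, hA1 h]
    · simp only [h, if_false]; split_ifs <;> norm_num
  have hc : ∀ y, cnv (ind A1) y ≤ cnv (ind (tr A x)) y := by
    intro y
    unfold cnv
    exact Finset.sum_le_sum fun z _ => mul_le_mul (hmono _) (hmono _) (ind_nonneg _ _) (ind_nonneg _ _)
  have hc0 : ∀ y, 0 ≤ cnv (ind (tr A x)) y := fun y =>
    Finset.sum_nonneg fun z _ => mul_nonneg (ind_nonneg _ _) (ind_nonneg _ _)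
  calc _ ≤ ∑ u ∈ Q, T3 A := by
        refine Finset.sum_le_sum fun u _ => ?_
        rw [← T3_tr A x]
        unfold T3
        rw [← Equiv.sum_comp (Equiv.addLeft u)]
        calc _ ≤ ∑ v ∈ Q, ind (tr A x) (u + v) * cnv (ind (tr A x)) (u + v + (u + v)) := by
              refine Finset.sum_le_sum fun v _ => ?_
              rw [← ind_tr]
              exact mul_le_mul_of_nonneg_left (hc _) (ind_nonneg _ _)
          _ ≤ _ := Finset.sum_le_sum_of_subset_of_nonneg (Finset.subset_univ _)
              fun v _ _ => mul_nonneg (ind_nonneg _ _) (hc0 _)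
    _ = _ := by simp
end KM

namespace KM
open Finset
set_option linter.unusedSectionVars false
variable {G : Type*} [AddCommGroup G] [Fintype G] [DecidableEq G]

/-- state of the density increment iteration -/
def St (ℓ : ℕ) (A : Finset G) (d i : ℕ) (α : ℝ) : Prop :=
  ∃ (Γ : Finset (AddChar G ℂ)) (ρ : ℝ) (x : G), Γ.card ≤ d ∧ 0 ≤ ρ ∧
    ((Bohr Γ (ρ + (1 / 2) ^ i)).card : ℝ) ≤ (1 + (1 / 2) ^ (ℓ + 14)) * (Bohr Γ ρ).card ∧
    α * (Bohr Γ ρ).card ≤ cnt A (Bohr Γ ρ) x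

lemma St_tr {ℓ : ℕ} {A : Finset G} {d i : ℕ} {α : ℝ} {y : G} (h : St ℓ (tr A y) d i α) :
    St ℓ A d i α := by
  obtain ⟨Γ, ρ, x, h1, h2, h3, h4⟩ := h
  exact ⟨Γ, ρ, x + y, h1, h2, h3, by rwa [cnt_tr] at h4⟩

lemma St_le {ℓ : ℕ} {A : Finset G} {d i : ℕ} {α : ℝ} (h : St ℓ A d i α) : α ≤ 1 := by
  obtain ⟨Γ, ρ, x, h1, h2, h3, h4⟩ := h
  have hc : (0 : ℝ) < (Bohr Γ ρ).card := by exact_mod_cast (bohr_nonempty h2).card_pos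
  have := h4.trans (cnt_le _ _ _)
  by_contra hcon
  push Not at hcon
  nlinarith

lemma half_le {a b : ℕ} (h : b ≤ a) : ((1 : ℝ) / 2) ^ a ≤ (1 / 2) ^ b :=
  pow_le_pow_of_le_one (by norm_num) (by norm_num) h

lemma half_mul {m κ a b : ℕ} (hm : m ≤ 2 ^ κ) (h : b + κ ≤ a) {ρ : ℝ} (hρ : ρ ≤ (1 / 2) ^ a) :
    (m : ℝ) * ρ ≤ (1 / 2) ^ b := by
  have hm' : (m : ℝ) ≤ 2 ^ κ := by exact_mod_cast hm
  calc (m : ℝ) * ρ ≤ m * (1 / 2) ^ a := by gcongr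
    _ ≤ 2 ^ κ * (1 / 2) ^ (b + κ) := by
      have := half_le h
      gcongr
    _ = (1 / 2) ^ b := by
      rw [pow_add, mul_left_comm, ← mul_pow]; norm_num

lemma sum_dbl (e : G ≃+ G) (Q : Finset G) (f : G → G → ℝ) :
    ∑ u ∈ Q.image e, ∑ v ∈ Q.image e, f u v = ∑ u ∈ Q, ∑ v ∈ Q, f (e u) (e v) := by
  rw [Finset.sum_image (fun a _ b _ h => e.injective h)]
  refine Finset.sum_congr rfl fun u _ => ?_
  rw [Finset.sum_image (fun a _ b _ h => e.injective h)]

set_option maxHeartbeats 2000000 in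
open Classical in
lemma step0 (dbl : G ≃+ G) (hdbl : ∀ x, dbl x = x + x) (ℓ κ d i I D : ℕ) (hℓ : 1 ≤ ℓ) (hκ : 1 ≤ κ)
    (hκ1 : 20 * ℓ ≤ 2 ^ κ) (hκ2 : MM ℓ ≤ 2 ^ κ)
    (hJ : 2 ^ (ℓ + 14) * (2 * (I + 4) * D) ≤ 2 ^ κ) (hI : i + 24 * κ ≤ I) (hD : d + MM ℓ ≤ D)
    (A : Finset G) (α : ℝ) (hα : (1 / 2) ^ ℓ ≤ α) (hα1 : α ≤ 1)
    (Γ : Finset (AddChar G ℂ)) (ρ : ℝ) (hΓ : Γ.card ≤ d) (hρ : 0 ≤ ρ)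
    (hreg : ((Bohr Γ (ρ + (1 / 2) ^ i)).card : ℝ) ≤ (1 + (1 / 2) ^ (ℓ + 14)) * (Bohr Γ ρ).card)
    (hden : α * (Bohr Γ ρ).card ≤ cnt A (Bohr Γ ρ) 0) :
    (1 / 2) ^ (3 * ℓ + 4) * ((Bohr Γ ((1 / 2) ^ I)).card : ℝ) ^ 2 ≤ T3 A ∨
    ∃ i' ≤ i + 24 * κ, St ℓ A (d + MM ℓ) i' (1.002 * α) := by
  have hR : ∀ (Δ : Finset (AddChar G ℂ)) (j : ℕ), Δ.card ≤ D → j ≤ I →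
      ∃ ρ : ℝ, (1 / 2) ^ (j + 1) ≤ ρ ∧ ρ ≤ (1 / 2) ^ j ∧
      ((Bohr Δ (ρ + (1 / 2) ^ (j + 1 + κ))).card : ℝ) ≤ (1 + (1 / 2) ^ (ℓ + 14)) * (Bohr Δ ρ).card := by
    intro Δ j hΔ hj
    refine bohr_reg Δ D j (ℓ + 14) κ hΔ (le_trans ?_ hJ)
    gcongr
  have hαp : 0 < α := lt_of_lt_of_le (by positivity) hα
  set δ : ℝ := (1 / 2) ^ (ℓ + 14) with hδ
  have hδ0 : 0 ≤ δ := by positivity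
  have hδα : 16384 * δ ≤ α := by
    rw [hδ, pow_add]; norm_num at hα ⊢; linarith
  have hδ1 : δ ≤ 1 := by rw [hδ]; exact pow_le_one₀ (by norm_num) (by norm_num)
  obtain ⟨ρ1, h1a, h1b, h1c⟩ := hR Γ i (by omega) (by omega)
  obtain ⟨ρ2, h2a, h2b, h2c⟩ := hR Γ (i + 3 + κ) (by omega) (by omega)
  have hρ1 : 0 ≤ ρ1 := le_trans (by positivity) h1a
  have hρ2 : 0 ≤ ρ2 := le_trans (by positivity) h2a
  set P := Bohr Γ ρ1 with hP
  set Q := Bohr Γ ρ2 with hQ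
  have hPne : P.Nonempty := bohr_nonempty hρ1
  have hQne : Q.Nonempty := bohr_nonempty hρ2
  have hPc : (0 : ℝ) < P.card := by exact_mod_cast hPne.card_pos
  have hQc : (0 : ℝ) < Q.card := by exact_mod_cast hQne.card_pos
  by_cases hPu : ∀ x, cnt A P x ≤ (1 + 0.002) * α * P.card
  swap
  · push Not at hPu
    obtain ⟨x, hx⟩ := hPu
    refine Or.inr ⟨i + 1 + κ, by omega, Γ, ρ1, x, by omega, hρ1, h1c, ?_⟩
    have e : (1.002 : ℝ) = 1 + 0.002 := by norm_num
    rw [e]; exact hx.le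
  by_cases hQu : ∀ x, cnt A Q x ≤ (1 + 0.002) * α * Q.card
  swap
  · push Not at hQu
    obtain ⟨x, hx⟩ := hQu
    refine Or.inr ⟨i + 3 + κ + 1 + κ, by omega, Γ, ρ2, x, by omega, hρ2, h2c, ?_⟩
    have e : (1.002 : ℝ) = 1 + 0.002 := by norm_num
    rw [e]; exact hx.le
  obtain ⟨x, hx1, hx2⟩ := good_translate (δ := δ) (B := Bohr Γ ρ) hPne hQne (bohr_nonempty hρ) hden
    (fun t ht => bohr_regAt (by positivity) hreg (bohr_mono h1b (bohr_neg ht)))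
    (fun t ht t' ht' => bohr_regAt (by positivity) hreg (bohr_mono (by
      have : (i + 3 + κ) = (i + 2 + κ) + 1 := by omega
      have h3 : ρ2 + ρ2 ≤ (1 / 2) ^ (i + 2 + κ) := by
        rw [this, pow_succ] at h2b; linarith
      exact h3.trans (half_le (by omega))) (bohr_neg (bohr_add ht ht')))) hPu hQu (by linarith)
  set A1 := P.filter fun y => y + x ∈ A with hA1
  have hA1c : cnt A P x = A1.card := cnt_eq _ _ _
  obtain ⟨α1, hαOneDef⟩ : ∃ a : ℝ, a = A1.card / P.card := ⟨_, rfl⟩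
  have hA1α : (A1.card : ℝ) = α1 * P.card := by rw [hαOneDef]; field_simp
  have hαOneLow : 0.996 * α ≤ α1 := by
    rw [hαOneDef, le_div_iff₀ hPc, ← hA1c]
    norm_num at hx1 ⊢; linarith
  have hαOneHalf : (1 / 2 : ℝ) ^ (ℓ + 1) ≤ α1 := by
    rw [pow_succ]; linarith
  have hαOneUp : α1 ≤ 1 := by
    rw [hαOneDef, div_le_one hPc]; exact_mod_cast Finset.card_filter_le _ _
  clear hαOneDef
  have hα10 : 0 < α1 := lt_of_lt_of_le (by positivity) hαOneHalf
  have hA1ne : A1.Nonempty := by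
    rw [← Finset.card_pos]
    have : (0 : ℝ) < A1.card := by rw [hA1α]; exact mul_pos hα10 hPc
    exact_mod_cast this
  have hA1tr : A1 ⊆ tr A x := by
    intro y hy
    rw [hA1, Finset.mem_filter] at hy
    simp [tr, hy.2]
  set ω : G → G → ℝ := fun u v => ind A (dbl.symm u + dbl.symm v + x) with hω
  have hE : Bohr (tw dbl Γ) ρ2 = Q.image dbl := bohr_tw dbl Γ ρ2
  have hEc : (Bohr (tw dbl Γ) ρ2).card = Q.card := bohr_tw_card dbl Γ ρ2
  have hωs : ∑ u ∈ Bohr (tw dbl Γ) ρ2, ∑ v ∈ Bohr (tw dbl Γ) ρ2, ω u v =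
      ∑ u ∈ Q, ∑ v ∈ Q, ind A (u + v + x) := by
    rw [hE, sum_dbl]; simp [hω]
  have hωs2 : ∑ u ∈ Bohr (tw dbl Γ) ρ2, ∑ v ∈ Bohr (tw dbl Γ) ρ2, ω u v * cnv (ind A1) (u + v) =
      ∑ u ∈ Q, ∑ v ∈ Q, ind A (u + v + x) * cnv (ind A1) (u + v + (u + v)) := by
    rw [hE, sum_dbl]
    refine Finset.sum_congr rfl fun u _ => Finset.sum_congr rfl fun v _ => ?_
    have e1 : dbl u + dbl v = u + v + (u + v) := by rw [← map_add, hdbl]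
    simp only [hω, AddEquiv.symm_apply_apply, e1]
  have hωl : 0.996 * α * (Q.card : ℝ) ^ 2 ≤ ∑ u ∈ Q, ∑ v ∈ Q, ind A (u + v + x) := by
    norm_num at hx2 ⊢; linarith
  by_cases hfew : ∑ u ∈ Bohr (tw dbl Γ) ρ2, ∑ v ∈ Bohr (tw dbl Γ) ρ2, ω u v * cnv (ind A1) (u + v) ≤
      (1 / 2) * (α1 ^ 2 * P.card) * ∑ u ∈ Bohr (tw dbl Γ) ρ2, ∑ v ∈ Bohr (tw dbl Γ) ρ2, ω u v
  swap
  · left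
    push Not at hfew
    rw [hωs, hωs2] at hfew
    have hm := many_aps (Q := Q) x hA1tr
    have hK1 : ((Bohr Γ ((1 / 2) ^ I)).card : ℝ) ≤ P.card := by
      exact_mod_cast Finset.card_le_card (bohr_mono ((half_le (by omega)).trans h1a))
    have hK2 : ((Bohr Γ ((1 / 2) ^ I)).card : ℝ) ≤ Q.card := by
      exact_mod_cast Finset.card_le_card (bohr_mono ((half_le (by omega)).trans h2a))
    have b1 : (1 / 2) * (α1 ^ 2 * P.card) * (0.996 * α * (Q.card : ℝ) ^ 2) ≤ Q.card * T3 A := by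
      refine le_trans ?_ (hfew.le.trans hm)
      gcongr
    have b2 : (1 / 2) * (α1 ^ 2 * P.card) * (0.996 * α * Q.card) ≤ T3 A := by
      refine le_of_mul_le_mul_left ?_ hQc
      calc _ = (1 / 2) * (α1 ^ 2 * P.card) * (0.996 * α * (Q.card : ℝ) ^ 2) := by ring
        _ ≤ _ := b1
    refine le_trans ?_ b2
    have b3 : (1 / 2 : ℝ) ^ (ℓ + 1) ≤ 0.996 * α := by rw [pow_succ]; linarith
    calc (1 / 2 : ℝ) ^ (3 * ℓ + 4) * ((Bohr Γ ((1 / 2) ^ I)).card : ℝ) ^ 2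
        = (1 / 2) * (((1 / 2 : ℝ) ^ (ℓ + 1)) ^ 2 * (Bohr Γ ((1 / 2) ^ I)).card) *
          ((1 / 2 : ℝ) ^ (ℓ + 1) * (Bohr Γ ((1 / 2) ^ I)).card) := by ring
      _ ≤ _ := by gcongr
  right
  obtain ⟨X, hXD, hX, hbad⟩ := propA ℓ hℓ (P := P) (A := A1) (D := Bohr (tw dbl Γ) ρ2)
    (fun y hy => bohr_neg hy) (fun y hy => bohr_neg hy) (bohr_nonempty hρ2) (Finset.filter_subset _ _)
    hA1α hPne hαOneHalf hαOneUp hδ0 (by linarith) (by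
      intro u hu v hv
      rw [mem_bohr_tw] at hu hv
      refine bohr_regAt (by positivity) h1c ?_
      have e1 : u - v = (dbl.symm u - dbl.symm v) + (dbl.symm u - dbl.symm v) := by
        rw [← hdbl, map_sub]; simp
      rw [e1]
      have h3 : (ρ2 + ρ2) + (ρ2 + ρ2) ≤ (1 / 2) ^ (i + 1 + κ) := by
        have : (i + 3 + κ) = (i + 1 + κ) + 1 + 1 := by omega
        rw [this, pow_succ, pow_succ] at h2b; linarith
      exact bohr_mono h3 (bohr_add (bohr_sub hu hv) (bohr_sub hu hv))) ω
    (fun u v => ind_nonneg _ _) (fun u v => ind_le_one _ _) (by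
      rw [hωs, hEc]
      refine le_trans ?_ hωl
      have b3 : (1 / 2 : ℝ) ^ (ℓ + 1) ≤ 0.996 * α := by rw [pow_succ]; linarith
      gcongr) hfew
    (fun x => 1.025 * (α1 ^ 2 * P.card) ≤ corr (ind A1) x) (fun x => Iff.rfl)
  have htw : (tw dbl Γ).card ≤ d := (tw_card dbl Γ).trans hΓ
  obtain ⟨ρ3, h3a, h3b, h3c⟩ := hR (tw dbl Γ) (i + 3 + κ + 1 + 2 * κ) (by omega) (by omega)
  obtain ⟨ρ4, h4a, h4b, h4c⟩ := hR (tw dbl Γ) (i + 3 + κ + 1 + 2 * κ + 1 + 2 * κ) (by omega) (by omega)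
  have hρ3 : 0 ≤ ρ3 := le_trans (by positivity) h3a
  have hρ4 : 0 ≤ ρ4 := le_trans (by positivity) h4a
  obtain ⟨Λ, hΛ, hinc⟩ := increment ℓ hℓ (tw dbl Γ) hA1ne hαOneHalf hA1α hρ2 hρ3 hρ4
    (σ4 := (1 / 2) ^ (i + 3 + κ + 1 + 2 * κ + 1 + 2 * κ + 1 + κ)) (by positivity)
    (σ2 := (1 / 2) ^ (i + 3 + κ + 1 + κ))
    (by
      rw [bohr_tw_card, bohr_tw_card]
      refine h2c.trans ?_
      gcongr; linarith)
    (by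
      have := half_mul hκ1 (b := i + 3 + κ + 1 + κ) (by omega) h3b
      push_cast at this; exact this)
    (σ3 := (1 / 2) ^ (i + 3 + κ + 1 + 2 * κ + 1 + κ))
    (by
      refine h3c.trans ?_
      gcongr; linarith)
    (half_mul hκ2 (by omega) h4b)
    (by
      refine h4c.trans ?_
      have := half_le (show 15 ≤ ℓ + 14 by omega)
      gcongr)
    hXD hX (fun x => 1.025 * (α1 ^ 2 * P.card) ≤ corr (ind A1) x) (fun x => Iff.rfl) hbad
  have hun : (tw dbl Γ ∪ Λ).card ≤ d + MM ℓ := (Finset.card_union_le _ _).trans (by omega)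
  obtain ⟨ρ5, h5a, h5b, h5c⟩ := hR (tw dbl Γ ∪ Λ) (i + 16 + 6 * κ) (by omega) (by omega)
  have hρ5 : 0 ≤ ρ5 := le_trans (by positivity) h5a
  have hMM : (0 : ℝ) < MM ℓ := by
    have : 0 < MM ℓ := by unfold MM; positivity
    exact_mod_cast this
  obtain ⟨z, hz⟩ := hinc (Bohr (tw dbl Γ ∪ Λ) ρ5)
    (by
      intro y hy
      rw [mem_bohr] at hy ⊢
      intro γ hγ
      exact (hy γ (Finset.mem_union_left _ hγ)).trans (h5b.trans (half_le (by omega))))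
    (by
      intro y hy l hl
      rw [mem_bohr] at hy
      refine (hy l (Finset.mem_union_right _ hl)).trans ?_
      rw [le_div_iff₀ hMM, mul_comm]
      refine (half_mul (b := 10) hκ2 (by omega) h5b).trans ?_
      norm_num)
  refine ⟨i + 16 + 6 * κ + 1 + κ, by omega, tw dbl Γ ∪ Λ, ρ5, z + x, hun, hρ5, h5c, ?_⟩
  have hfin : (((Bohr (tw dbl Γ ∪ Λ) ρ5).filter fun b => b + z ∈ A1).card : ℝ) ≤
      cnt A (Bohr (tw dbl Γ ∪ Λ) ρ5) (z + x) := by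
    rw [cnt_eq]
    norm_cast
    refine Finset.card_le_card fun y hy => ?_
    rw [Finset.mem_filter] at hy ⊢
    refine ⟨hy.1, ?_⟩
    rw [← add_assoc]
    exact (Finset.mem_filter.mp hy.2).2
  refine le_trans ?_ (hz.trans hfin)
  have : 1.002 * α ≤ 1.016 * α1 := by linarith
  gcongr

lemma step (dbl : G ≃+ G) (hdbl : ∀ x, dbl x = x + x) (ℓ κ d i I D : ℕ) (hℓ : 1 ≤ ℓ) (hκ : 1 ≤ κ)
    (hκ1 : 20 * ℓ ≤ 2 ^ κ) (hκ2 : MM ℓ ≤ 2 ^ κ)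
    (hJ : 2 ^ (ℓ + 14) * (2 * (I + 4) * D) ≤ 2 ^ κ) (hI : i + 24 * κ ≤ I) (hD : d + MM ℓ ≤ D)
    (A : Finset G) (α : ℝ) (hα : (1 / 2) ^ ℓ ≤ α) (h : St ℓ A d i α) :
    (1 / 2) ^ (3 * ℓ + 4 + 4 * (I + 3) * D) * (Fintype.card G : ℝ) ^ 2 ≤ T3 A ∨
    ∃ i' ≤ i + 24 * κ, St ℓ A (d + MM ℓ) i' (1.002 * α) := by
  have hα1 := St_le h
  obtain ⟨Γ, ρ, x, h1, h2, h3, h4⟩ := h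
  rcases step0 dbl hdbl ℓ κ d i I D hℓ hκ hκ1 hκ2 hJ hI hD (tr A x) α hα hα1 Γ ρ h1 h2 h3
    (by rw [cnt_tr, zero_add]; exact h4) with h | ⟨i', hi', h⟩
  · left
    rw [T3_tr] at h
    refine le_trans ?_ h
    have hs := bohr_size Γ I (le_refl ((1 / 2 : ℝ) ^ I))
    have hs' : (Fintype.card G : ℝ) ≤ 2 ^ (2 * (I + 3) * D) * (Bohr Γ ((1 / 2) ^ I)).card := by
      refine hs.trans ?_
      have : Γ.card ≤ D := by omega
      gcongr
      norm_num
    rw [pow_add, mul_assoc]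
    gcongr
    calc ((1 : ℝ) / 2) ^ (4 * (I + 3) * D) * (Fintype.card G : ℝ) ^ 2
        ≤ (1 / 2) ^ (4 * (I + 3) * D) * (2 ^ (2 * (I + 3) * D) * (Bohr Γ ((1 / 2) ^ I)).card) ^ 2 := by
          gcongr
      _ = ((1 / 2) ^ (4 * (I + 3) * D) * 2 ^ (4 * (I + 3) * D)) * ((Bohr Γ ((1 / 2) ^ I)).card : ℝ) ^ 2 := by
          rw [mul_pow, ← pow_mul]; ring_nf
      _ = _ := by rw [← mul_pow]; norm_num
  · exact Or.inr ⟨i', hi', St_tr h⟩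
end KM

namespace KM
open Finset
set_option linter.unusedSectionVars false
variable {G : Type*} [AddCommGroup G] [Fintype G] [DecidableEq G]

lemma iter (dbl : G ≃+ G) (hdbl : ∀ x, dbl x = x + x) (ℓ κ n : ℕ) (hℓ : 1 ≤ ℓ) (hκ : 1 ≤ κ)
    (hκ1 : 20 * ℓ ≤ 2 ^ κ) (hκ2 : MM ℓ ≤ 2 ^ κ)
    (hJ : 2 ^ (ℓ + 14) * (2 * (24 * κ * n + 4) * (n * MM ℓ)) ≤ 2 ^ κ)
    (A : Finset G) (hA : (1 / 2 : ℝ) ^ ℓ * Fintype.card G ≤ A.card)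
    (hT : T3 A < (1 / 2) ^ (3 * ℓ + 4 + 4 * (24 * κ * n + 3) * (n * MM ℓ)) * (Fintype.card G : ℝ) ^ 2) :
    ∀ k ≤ n, ∃ i ≤ 24 * κ * k, St ℓ A (k * MM ℓ) i (1.002 ^ k * (1 / 2) ^ ℓ) := by
  intro k
  induction k with
  | zero =>
    intro _
    refine ⟨0, by omega, ∅, 1, 0, by simp, by norm_num, ?_, ?_⟩
    · have e : ∀ r : ℝ, Bohr (∅ : Finset (AddChar G ℂ)) r = univ := by
        intro r; ext x; simp [mem_bohr]
      rw [e, e]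
      have : (0 : ℝ) ≤ (1 / 2) ^ (ℓ + 14) := by positivity
      have h2 : (0 : ℝ) ≤ (univ : Finset G).card := by positivity
      nlinarith
    · have e : ∀ r : ℝ, Bohr (∅ : Finset (AddChar G ℂ)) r = univ := by
        intro r; ext x; simp [mem_bohr]
      rw [e]
      have : cnt A univ 0 = A.card := by unfold cnt; simp [sum_ind]
      rw [this, Finset.card_univ, pow_zero, one_mul]
      exact hA
  | succ k ih =>
    intro hk
    obtain ⟨i, hi, hS⟩ := ih (by omega)
    have hkn : 24 * κ * k + 24 * κ ≤ 24 * κ * n := by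
      calc 24 * κ * k + 24 * κ = 24 * κ * (k + 1) := by ring
        _ ≤ _ := Nat.mul_le_mul_left _ hk
    have hD : k * MM ℓ + MM ℓ ≤ n * MM ℓ := by
      calc k * MM ℓ + MM ℓ = (k + 1) * MM ℓ := by ring
        _ ≤ _ := Nat.mul_le_mul_right _ hk
    rcases step dbl hdbl ℓ κ (k * MM ℓ) i (24 * κ * n) (n * MM ℓ) hℓ hκ hκ1 hκ2 hJ (by omega) hD A _
      (by
        have : (1 : ℝ) ≤ 1.002 ^ k := one_le_pow₀ (by norm_num)
        have h2 : (0 : ℝ) < (1 / 2) ^ ℓ := by positivity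
        nlinarith) hS with h | ⟨i', hi', h⟩
    · exact absurd hT (not_lt.mpr h)
    · refine ⟨i', by rw [Nat.mul_succ]; omega, ?_⟩
      rw [Nat.succ_mul, pow_succ]
      have e : (1.002 : ℝ) ^ k * 1.002 * (1 / 2) ^ ℓ = 1.002 * (1.002 ^ k * (1 / 2) ^ ℓ) := by ring
      rw [e]
      exact h

lemma params (ℓ : ℕ) (hℓ : 1 ≤ ℓ) :
    20 * ℓ ≤ 2 ^ (200 * ℓ) ∧ MM ℓ ≤ 2 ^ (200 * ℓ) ∧
    2 ^ (ℓ + 14) * (2 * (24 * (200 * ℓ) * (500 * ℓ) + 4) * (500 * ℓ * MM ℓ)) ≤ 2 ^ (200 * ℓ) ∧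
    3 * ℓ + 4 + 4 * (24 * (200 * ℓ) * (500 * ℓ) + 3) * (500 * ℓ * MM ℓ) ≤ 10 ^ 26 * ℓ ^ 11 := by
  have h1 : ℓ ≤ 2 ^ ℓ := Nat.lt_two_pow_self.le
  have hM : 500 * ℓ * MM ℓ = 5 * 10 ^ 18 * ℓ ^ 7 := by unfold MM; ring
  have hq : 1 ≤ ℓ ^ 2 := Nat.one_le_pow _ _ hℓ
  have hbig : 2 ^ (ℓ + 14) * (2 * (24 * (200 * ℓ) * (500 * ℓ) + 4) * (500 * ℓ * MM ℓ)) ≤ 2 ^ (200 * ℓ) := by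
    rw [hM]
    calc 2 ^ (ℓ + 14) * (2 * (24 * (200 * ℓ) * (500 * ℓ) + 4) * (5 * 10 ^ 18 * ℓ ^ 7))
        ≤ 2 ^ (ℓ + 14) * (2 * (2 ^ 23 * ℓ ^ 2) * (2 ^ 63 * ℓ ^ 7)) := by
          gcongr
          · nlinarith
          · norm_num
      _ = 2 ^ (ℓ + 101) * ℓ ^ 9 := by ring
      _ ≤ 2 ^ (ℓ + 101) * (2 ^ ℓ) ^ 9 := by gcongr
      _ = 2 ^ (10 * ℓ + 101) := by rw [← pow_mul, ← pow_add]; congr 1; ring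
      _ ≤ _ := Nat.pow_le_pow_right (by norm_num) (by omega)
  refine ⟨?_, ?_, hbig, ?_⟩
  · calc 20 * ℓ ≤ 2 ^ 5 * 2 ^ ℓ := by gcongr; norm_num
      _ = 2 ^ (5 + ℓ) := by rw [pow_add]
      _ ≤ _ := Nat.pow_le_pow_right (by norm_num) (by omega)
  · unfold MM
    calc 10 ^ 16 * ℓ ^ 6 ≤ 2 ^ 64 * (2 ^ ℓ) ^ 6 :=
        Nat.mul_le_mul (by norm_num) (Nat.pow_le_pow_left h1 _)
      _ = 2 ^ (64 + 6 * ℓ) := by rw [← pow_mul, ← pow_add]; congr 1; ring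
      _ ≤ _ := Nat.pow_le_pow_right (by norm_num) (by omega)
  · rw [hM]
    have h11 : ℓ ^ 9 ≤ ℓ ^ 11 := Nat.pow_le_pow_right hℓ (by norm_num)
    have h9 : 1 ≤ ℓ ^ 9 := Nat.one_le_pow _ _ hℓ
    have h9' : ℓ ≤ ℓ ^ 9 := by
      calc ℓ = ℓ ^ 1 := by ring
        _ ≤ _ := Nat.pow_le_pow_right hℓ (by norm_num)
    calc 3 * ℓ + 4 + 4 * (24 * (200 * ℓ) * (500 * ℓ) + 3) * (5 * 10 ^ 18 * ℓ ^ 7)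
        ≤ 3 * ℓ ^ 9 + 4 * ℓ ^ 9 + 4 * (24 * (200 * ℓ) * (500 * ℓ) + 3 * ℓ ^ 2) * (5 * 10 ^ 18 * ℓ ^ 7) := by
          gcongr <;> omega
      _ = 48000060000000000000000007 * ℓ ^ 9 := by ring
      _ ≤ 10 ^ 26 * ℓ ^ 11 := by gcongr; norm_num

lemma km_group (dbl : G ≃+ G) (hdbl : ∀ x, dbl x = x + x) (ℓ : ℕ) (hℓ : 1 ≤ ℓ)
    (A : Finset G) (hA : (1 / 2 : ℝ) ^ ℓ * Fintype.card G ≤ A.card) :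
    (1 / 2 : ℝ) ^ (10 ^ 26 * ℓ ^ 11) * (Fintype.card G : ℝ) ^ 2 ≤ T3 A := by
  obtain ⟨p1, p2, p3, p4⟩ := params ℓ hℓ
  by_contra hcon
  push Not at hcon
  have hT := hcon.trans_le (mul_le_mul_of_nonneg_right (half_le p4) (sq_nonneg (Fintype.card G : ℝ)))
  obtain ⟨i, -, hS⟩ := iter dbl hdbl ℓ (200 * ℓ) (500 * ℓ) hℓ (by omega) p1 p2 p3 A hA hT (500 * ℓ) le_rfl
  have h1 := St_le hS
  rw [pow_mul, ← mul_pow] at h1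
  have h2 : (1 : ℝ) < (1.002 ^ 500 * (1 / 2)) := by
    have a : (1.1 : ℝ) ≤ 1.002 ^ 50 := by norm_num
    have b : (1.1 : ℝ) ^ 10 ≤ (1.002 ^ 50) ^ 10 := pow_le_pow_left₀ (by norm_num) a _
    have c : ((1.002 : ℝ) ^ 50) ^ 10 = 1.002 ^ 500 := by rw [← pow_mul]
    rw [c] at b
    have e : (2 : ℝ) < 1.1 ^ 10 := by norm_num
    have f := e.trans_le b
    generalize (1.002 : ℝ) ^ 500 = t at f ⊢
    linarith
  exact absurd h1 (not_le.mpr (one_lt_pow₀ h2 (by omega)))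
end KM

namespace KM
open Finset

/-- doubling on a cyclic group of odd order -/
noncomputable def dblZ (N : ℕ) : ZMod (2 * N + 1) ≃+ ZMod (2 * N + 1) :=
  AddEquiv.ofBijective (nsmulAddMonoidHom 2 : ZMod (2 * N + 1) →+ ZMod (2 * N + 1)) (by
    rw [← Finite.injective_iff_bijective]
    intro x y h
    simp only [nsmulAddMonoidHom_apply, nsmul_eq_mul] at h
    have h0 : ((2 * N + 1 : ℕ) : ZMod (2 * N + 1)) = 0 := ZMod.natCast_self _
    push_cast at h0 h
    have h1 : ((N : ZMod (2 * N + 1)) + 1) * 2 = 1 := by linear_combination h0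
    calc x = ((N : ZMod (2 * N + 1)) + 1) * 2 * x := by rw [h1, one_mul]
      _ = ((N : ZMod (2 * N + 1)) + 1) * 2 * y := by rw [mul_assoc, h, mul_assoc]
      _ = y := by rw [h1, one_mul])

lemma dblZ_apply (N : ℕ) (x : ZMod (2 * N + 1)) : dblZ N x = x + x := by
  simp [dblZ, two_mul]

lemma cast_inj {N a b : ℕ} (ha : a < 2 * N + 1) (hb : b < 2 * N + 1)
    (h : (a : ZMod (2 * N + 1)) = b) : a = b := by
  rw [ZMod.natCast_eq_natCast_iff] at h
  exact Nat.ModEq.eq_of_lt_of_lt h ha hb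

lemma T3_int (N : ℕ) (A : Finset ℕ) (hA : A ⊆ Finset.Icc 1 N) :
    T3 (A.image (fun a : ℕ => (a : ZMod (2 * N + 1)))) ≤
      (((A ×ˢ A ×ˢ A).filter fun t => t.1 + t.2.2 = 2 * t.2.1).card : ℝ) := by
  have hb : ∀ a ∈ A, 1 ≤ a ∧ a ≤ N := fun a ha => by simpa using hA ha
  have hinj : Set.InjOn (fun a : ℕ => (a : ZMod (2 * N + 1))) A := by
    intro a ha b hb' h
    have h1 := hb a ha
    have h2 := hb b hb'
    exact cast_inj (by omega) (by omega) h
  set A' := A.image (fun a : ℕ => (a : ZMod (2 * N + 1))) with hA'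
  have key : ∀ f : ZMod (2 * N + 1) → ℝ, ∑ x, ind A' x * f x = ∑ a ∈ A, f a := by
    intro f
    rw [← Finset.sum_image (s := A) (g := fun a : ℕ => (a : ZMod (2 * N + 1))) (f := f) hinj, ← hA']
    simp [ind]
  have hT : T3 A' = ∑ b ∈ A, ∑ a ∈ A, ind A' ((b : ZMod (2 * N + 1)) + b - a) := by
    unfold T3
    rw [key]
    refine Finset.sum_congr rfl fun b _ => ?_
    unfold cnv
    exact key _
  have hR : (((A ×ˢ A ×ˢ A).filter fun t => t.1 + t.2.2 = 2 * t.2.1).card : ℝ) =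
      ∑ a ∈ A, ∑ b ∈ A, ∑ c ∈ A, if a + c = 2 * b then (1 : ℝ) else 0 := by
    rw [Finset.card_filter, Finset.sum_product]
    push_cast
    refine Finset.sum_congr rfl fun a _ => ?_
    rw [Finset.sum_product]
  rw [hT, hR, Finset.sum_comm]
  refine Finset.sum_le_sum fun a ha => Finset.sum_le_sum fun b hb' => ?_
  by_cases h : (b : ZMod (2 * N + 1)) + b - a ∈ A'
  · rw [hA', Finset.mem_image] at h
    obtain ⟨c, hc, hcc⟩ := h
    have e : ((a + c : ℕ) : ZMod (2 * N + 1)) = ((2 * b : ℕ) : ZMod (2 * N + 1)) := by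
      push_cast
      linear_combination hcc
    have h1 := hb a ha
    have h2 := hb b hb'
    have h3 := hb c hc
    have e2 := cast_inj (by omega) (by omega) e
    calc ind A' ((b : ZMod (2 * N + 1)) + b - a) ≤ 1 := ind_le_one _ _
      _ = if a + c = 2 * b then (1 : ℝ) else 0 := by rw [if_pos e2]
      _ ≤ _ := Finset.single_le_sum (f := fun c => if a + c = 2 * b then (1 : ℝ) else 0)
        (fun c _ => by split_ifs <;> norm_num) hc
  · have : ind A' ((b : ZMod (2 * N + 1)) + b - a) = 0 := by simp [ind, h]
    rw [this]
    exact Finset.sum_nonneg fun c _ => by split_ifs <;> norm_num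

lemma numerics {L : ℝ} (hL : Real.log 2 ≤ L) : ∃ ℓ : ℕ, 1 ≤ ℓ ∧
    2 * Real.exp L ≤ 2 ^ ℓ ∧ (ℓ : ℝ) ≤ 6 * L := by
  have l2 : 0 < Real.log 2 := Real.log_pos (by norm_num)
  have l3 : 0.5 < Real.log 2 := by linarith [Real.log_two_gt_d9]
  have hL0 : 0 ≤ L / Real.log 2 := div_nonneg (by linarith) l2.le
  refine ⟨⌈L / Real.log 2⌉₊ + 1, by omega, ?_, ?_⟩
  · rw [pow_succ, mul_comm]
    gcongr
    calc Real.exp L = Real.exp (L / Real.log 2 * Real.log 2) := by congr 1; field_simp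
      _ ≤ Real.exp (⌈L / Real.log 2⌉₊ * Real.log 2) := by
        gcongr
        exact Nat.le_ceil _
      _ = 2 ^ ⌈L / Real.log 2⌉₊ := by
        rw [Real.exp_nat_mul, Real.exp_log (by norm_num)]
  · have h1 := (Nat.ceil_lt_add_one hL0).le
    have h2 : L / Real.log 2 ≤ 2 * L := by
      rw [div_le_iff₀ l2]; nlinarith
    push_cast
    linarith

lemma final : ∃ C > (0 : ℝ), ∀ N : ℕ, 0 < N → ∀ A : Finset ℕ, A ⊆ Finset.Icc 1 N → A.Nonempty →
      Real.exp (-C * Real.log (2 / ((A.card : ℝ) / (N : ℝ))) ^ 11) * (N : ℝ) ^ 2 ≤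
        (((A ×ˢ A ×ˢ A).filter fun t => t.1 + t.2.2 = 2 * t.2.1).card : ℝ) := by
  refine ⟨10 ^ 26 * 6 ^ 11, by positivity, ?_⟩
  intro N hN A hA hne
  have hN' : (1 : ℝ) ≤ N := by exact_mod_cast hN
  have hc : (0 : ℝ) < A.card := by exact_mod_cast hne.card_pos
  have hcN : (A.card : ℝ) ≤ N := by
    have := Finset.card_le_card hA
    rw [Nat.card_Icc] at this
    exact_mod_cast this
  set α : ℝ := (A.card : ℝ) / N with hα
  have hα0 : 0 < α := by positivity
  have hα1 : α ≤ 1 := by rw [hα, div_le_one (by linarith)]; exact hcN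
  have hlog : Real.log 2 ≤ Real.log (2 / α) := by
    apply Real.log_le_log (by norm_num)
    rw [le_div_iff₀ hα0]; linarith
  obtain ⟨ℓ, hℓ, h1, h2⟩ := numerics hlog
  rw [Real.exp_log (by positivity)] at h1
  refine le_trans ?_ (T3_int N A hA)
  have hcard : (A.image (fun a : ℕ => (a : ZMod (2 * N + 1)))).card = A.card := by
    refine Finset.card_image_of_injOn ?_
    intro a ha b hb h
    have h1 : 1 ≤ a ∧ a ≤ N := by simpa using hA ha
    have h2 : 1 ≤ b ∧ b ≤ N := by simpa using hA hb
    exact cast_inj (by omega) (by omega) h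
  have hG : (Fintype.card (ZMod (2 * N + 1)) : ℝ) = 2 * N + 1 := by
    rw [ZMod.card]; push_cast; ring
  have hden : (1 / 2 : ℝ) ^ ℓ * Fintype.card (ZMod (2 * N + 1)) ≤
      (A.image (fun a : ℕ => (a : ZMod (2 * N + 1)))).card := by
    rw [hcard, hG, one_div, inv_pow, inv_mul_le_iff₀ (by positivity)]
    have e1 : (A.card : ℝ) = α * N := by rw [hα]; field_simp
    calc (2 * N + 1 : ℝ) ≤ 2 * (2 / α) * A.card := by
          rw [e1]
          have : 2 * (2 / α) * (α * N) = 4 * N := by field_simp; norm_num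
          rw [this]; linarith
      _ ≤ 2 ^ ℓ * A.card := mul_le_mul_of_nonneg_right h1 hc.le
  have hk := km_group (dblZ N) (dblZ_apply N) ℓ hℓ _ hden
  refine le_trans ?_ hk
  rw [hG]
  have hl2 : Real.log 2 ≤ 1 := by linarith [Real.log_two_lt_d9]
  have hl0 : 0 ≤ Real.log 2 := Real.log_nonneg (by norm_num)
  have hx : Real.exp (-(10 ^ 26 * 6 ^ 11) * Real.log (2 / α) ^ 11) ≤ (1 / 2 : ℝ) ^ (10 ^ 26 * ℓ ^ 11) := by
    have e : (1 / 2 : ℝ) ^ (10 ^ 26 * ℓ ^ 11) = Real.exp (((10 ^ 26 * ℓ ^ 11 : ℕ) : ℝ) * -Real.log 2) := by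
      rw [Real.exp_nat_mul, Real.exp_neg, Real.exp_log (by norm_num), one_div]
    rw [e, Real.exp_le_exp]
    have hp : (ℓ : ℝ) ^ 11 ≤ (6 * Real.log (2 / α)) ^ 11 := pow_le_pow_left₀ (by positivity) h2 _
    rw [mul_pow] at hp
    have hp0 : (0 : ℝ) ≤ (ℓ : ℝ) ^ 11 := by positivity
    rw [Nat.cast_mul, Nat.cast_pow, Nat.cast_pow]
    have : (ℓ : ℝ) ^ 11 * Real.log 2 ≤ (ℓ : ℝ) ^ 11 * 1 := mul_le_mul_of_nonneg_left hl2 hp0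
    generalize (ℓ : ℝ) ^ 11 = x at *
    generalize Real.log (2 / α) ^ 11 = y at *
    push_cast
    nlinarith
  gcongr
  linarith
end KM

/-- **Kelley–Meka, integer case (counting version).** There is a constant `C > 0` such that
for every positive integer `N` and every nonempty `A ⊆ {1,…,N}` with `|A| = αN`, the number of
triples `(a,b,c) ∈ A × A × A` with `a + c = 2b` is at least `exp(-C·(log(2/α))^11)·N²`. -/
theorem statement0 :
    ∃ C > (0 : ℝ), ∀ N : ℕ, 0 < N → ∀ A : Finset ℕ, A ⊆ Finset.Icc 1 N → A.Nonempty →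
      Real.exp (-C * Real.log (2 / ((A.card : ℝ) / (N : ℝ))) ^ 11) * (N : ℝ) ^ 2 ≤
        (((A ×ˢ A ×ˢ A).filter fun t => t.1 + t.2.2 = 2 * t.2.1).card : ℝ) := by
  exact KM.final
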